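/- arXiv:1809.09440 — 6 statements merged into one kernel-verified Lean document; each statement's English description precedes it below -/
import Mathlib

section
/- Let u, v ∈ ℂ with Re u > 1 and Re(u+v) > 2, let α ≥ 0, and let c be a real number with max(−Re u, 1−Re(u+v)) < c < −1. Define f(u,v,α) = ∑_{n=1}^∞ ∑_{m=1}^∞ (n+α)^{−v} (n+m+α)^{−u}. Then f(u,v,α) = (1/(2π)) ∫_{−∞}^{∞} [Γ(u+c+iy)/Γ(u)] · Γ(−c−iy) · ζ(−c−iy) · ζ₁(u+v+c+iy, α) dy. -/
open Complex MeasureTheory Real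

/-- The modified Hurwitz zeta function `ζ₁(s, α) = ∑_{n=1}^∞ (n+α)^{-s}`,
as an absolutely convergent series (valid for `Re s > 1`, `α ≥ 0`). -/
noncomputable def zeta1 (s : ℂ) (α : ℝ) : ℂ := ∑' n : ℕ, (((n : ℂ) + 1) + (α : ℂ)) ^ (-s)

/-- The double sum `f(u,v,α) = ∑_{n=1}^∞ ∑_{m=1}^∞ (n+α)^{-v} (n+m+α)^{-u}`. -/
noncomputable def fSum (u v : ℂ) (α : ℝ) : ℂ :=
  ∑' n : ℕ, ∑' m : ℕ,
    (((n : ℂ) + 1) + (α : ℂ)) ^ (-v) * (((n : ℂ) + 1) + ((m : ℂ) + 1) + (α : ℂ)) ^ (-u)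

open Set

theorem ofReal_cpow_eq_exp {x : ℝ} (hx : 0 < x) (w : ℂ) :
    (x : ℂ) ^ w = cexp (Real.log x * w) := by
  rw [cpow_def_of_ne_zero (ofReal_ne_zero.2 hx.ne'), ← ofReal_log hx.le]

theorem image_div_one_sub_Ioo : (fun t : ℝ ↦ t / (1 - t)) '' Ioo 0 1 = Ioi 0 := by
  ext x
  constructor
  · rintro ⟨t, ⟨h0, h1⟩, rfl⟩
    exact div_pos h0 (sub_pos.2 h1)
  · intro hx
    have hx : 0 < x := hx
    refine ⟨x / (1 + x), ⟨by positivity, ?_⟩, ?_⟩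
    · rw [div_lt_one (by positivity)]
      linarith
    · have : 1 + x ≠ 0 := by positivity
      have h : 1 - x / (1 + x) = 1 / (1 + x) := by field_simp; ring
      simp only [h]
      field_simp

theorem injOn_div_one_sub_Ioo : InjOn (fun t : ℝ ↦ t / (1 - t)) (Ioo 0 1) := by
  intro a ha b hb h
  have h1 : 1 - a ≠ 0 := (sub_pos.2 ha.2).ne'
  have h2 : 1 - b ≠ 0 := (sub_pos.2 hb.2).ne'
  simp only [div_eq_div_iff h1 h2] at h
  linarith

theorem hasDerivWithinAt_div_one_sub {t : ℝ} (ht : t ∈ Ioo (0 : ℝ) 1) :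
    HasDerivWithinAt (fun t : ℝ ↦ t / (1 - t)) (((1 - t) ^ 2)⁻¹) (Ioo 0 1) t := by
  have h1 : 1 - t ≠ 0 := (sub_pos.2 ht.2).ne'
  have := (hasDerivAt_id t).div ((hasDerivAt_id t).const_sub 1) h1
  refine (this.congr_deriv ?_).hasDerivWithinAt
  simp only [id]
  field_simp
  ring

theorem abs_deriv_smul_mellin_integrand (u s : ℂ) {t : ℝ} (ht : t ∈ Ioo (0 : ℝ) 1) :
    |((1 - t) ^ 2)⁻¹| • (((t / (1 - t) : ℝ) : ℂ) ^ (s - 1) •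
      ((1 + t / (1 - t) : ℝ) : ℂ) ^ (-u)) =
    (t : ℂ) ^ (s - 1) * (1 - (t : ℂ)) ^ (u - s - 1) := by
  have h0 := ht.1
  have h1 : 0 < 1 - t := sub_pos.2 ht.2
  have e1 : 1 + t / (1 - t) = (1 - t)⁻¹ := by field_simp; ring
  have e2 : (1 - (t : ℂ)) = ((1 - t : ℝ) : ℂ) := by push_cast; rfl
  have e3 : ((((1 - t) ^ 2)⁻¹ : ℝ) : ℂ) = cexp (Real.log (1 - t) * (-2)) := by
    rw [← ofReal_cpow_eq_exp h1, cpow_neg]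
    push_cast
    norm_cast
  rw [abs_of_pos (by positivity), e1, e2, real_smul, e3, smul_eq_mul,
    ofReal_cpow_eq_exp (by positivity), ofReal_cpow_eq_exp (by positivity),
    ofReal_cpow_eq_exp h0, ofReal_cpow_eq_exp h1, Real.log_div h0.ne' h1.ne', Real.log_inv,
    ← Complex.exp_add, ← Complex.exp_add, ← Complex.exp_add]
  congr 1
  push_cast
  ring

/-- The Mellin transform of `x ↦ (1 + x) ^ (-u)` is a Beta function. -/
theorem hasMellin_one_add_cpow_neg {u s : ℂ} (hs : 0 < s.re) (hsu : s.re < u.re) :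
    HasMellin (fun x : ℝ ↦ ((1 + x : ℝ) : ℂ) ^ (-u)) s
      (Complex.Gamma s * Complex.Gamma (u - s) / Complex.Gamma u) := by
  have hus : 0 < (u - s).re := by simpa using hsu
  constructor
  · rw [MellinConvergent, ← image_div_one_sub_Ioo,
      integrableOn_image_iff_integrableOn_abs_deriv_smul measurableSet_Ioo
        (fun t ht ↦ hasDerivWithinAt_div_one_sub ht) injOn_div_one_sub_Ioo,
      integrableOn_congr_fun (fun t ht ↦ abs_deriv_smul_mellin_integrand u s ht)
        measurableSet_Ioo]
    exact ((intervalIntegrable_iff_integrableOn_Ioo_of_le zero_le_one).1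
      (betaIntegral_convergent hs hus))
  · rw [mellin, ← image_div_one_sub_Ioo,
      integral_image_eq_integral_abs_deriv_smul measurableSet_Ioo
        (fun t ht ↦ hasDerivWithinAt_div_one_sub ht) injOn_div_one_sub_Ioo,
      setIntegral_congr_fun measurableSet_Ioo
        (fun t ht ↦ abs_deriv_smul_mellin_integrand u s ht),
      ← integral_Ioc_eq_integral_Ioo, ← intervalIntegral.integral_of_le zero_le_one]
    change betaIntegral s (u - s) = _
    rw [betaIntegral_eq_Gamma_mul_div _ _ hs hus, add_sub_cancel]

theorem continuousAt_Gamma_of_re_pos {s : ℂ} (hs : 0 < s.re) : ContinuousAt Complex.Gamma s := by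
  refine (differentiableAt_Gamma s fun m h ↦ ?_).continuousAt
  have : (0 : ℝ) ≤ m := m.cast_nonneg
  simp [h] at hs
  linarith

theorem norm_Gamma_le_Gamma_re {s : ℂ} (hs : 0 < s.re) :
    ‖Complex.Gamma s‖ ≤ Real.Gamma s.re := by
  rw [Complex.Gamma_eq_integral hs, Complex.GammaIntegral, Real.Gamma_eq_integral hs]
  refine (norm_integral_le_integral_norm _).trans_eq ?_
  refine setIntegral_congr_fun measurableSet_Ioi fun x hx ↦ ?_
  simp only [norm_mul, norm_cpow_eq_rpow_re_of_pos hx, sub_re, one_re, norm_real,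
    Real.norm_eq_abs, Real.abs_exp]

theorem integrable_inv_norm_add_mul_I_sq {a : ℂ} (ha : a.re ≠ 0) :
    Integrable fun y : ℝ ↦ (‖a + y * I‖ ^ 2)⁻¹ := by
  have h := ((integrable_inv_one_add_sq.comp_div ha).comp_add_right a.im).const_mul (a.re ^ 2)⁻¹
  refine h.congr (.of_forall fun y ↦ ?_)
  simp only [Complex.sq_norm, Complex.normSq_apply, ← mul_inv]
  congr 1
  simp
  field_simp
  ring

/-- Integrability of a product of Gamma functions along a vertical line. -/
theorem integrable_Gamma_mul_Gamma {a b : ℂ} (ha : 0 < a.re) (hb : 0 < b.re) :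
    Integrable fun y : ℝ ↦ Complex.Gamma (a + y * I) * Complex.Gamma (b - y * I) := by
  have hre (y : ℝ) : 0 < (a + y * I).re := by simpa using ha
  have hre' (y : ℝ) : 0 < (b - y * I).re := by simpa using hb
  have hcont : Continuous fun y : ℝ ↦
      Complex.Gamma (a + y * I) * Complex.Gamma (b - y * I) := by
    refine continuous_iff_continuousAt.2 fun y ↦ ContinuousAt.mul ?_ ?_
    · exact ContinuousAt.comp (f := fun y : ℝ ↦ a + y * I)
        (continuousAt_Gamma_of_re_pos (hre y)) (by fun_prop)
    · exact ContinuousAt.comp (f := fun y : ℝ ↦ b - y * I)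
        (continuousAt_Gamma_of_re_pos (hre' y)) (by fun_prop)
  have hint := (integrable_inv_norm_add_mul_I_sq ha.ne').add
    (integrable_inv_norm_add_mul_I_sq hb.ne').comp_neg
  refine (hint.const_mul (Real.Gamma (a.re + 1) * Real.Gamma (b.re + 1))).mono'
    hcont.aestronglyMeasurable (.of_forall fun y ↦ ?_)
  have bound {s : ℂ} (hs : 0 < s.re) :
      ‖Complex.Gamma s‖ ≤ Real.Gamma (s.re + 1) * ‖s‖⁻¹ := by
    have h0 : s ≠ 0 := fun h ↦ by simp [h] at hs
    have h := norm_Gamma_le_Gamma_re (s := s + 1) (by simp; linarith)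
    rw [Complex.Gamma_add_one s h0, norm_mul] at h
    rw [← div_eq_mul_inv, le_div_iff₀ (norm_pos_iff.2 h0), mul_comm]
    simpa using h
  have h1 := bound (hre y)
  have h2 := bound (hre' y)
  have e1 : (a + y * I).re = a.re := by simp
  have e2 : (b - y * I).re = b.re := by simp
  have e3 : b + ((-y : ℝ) : ℂ) * I = b - y * I := by push_cast; ring
  rw [e1] at h1
  rw [e2] at h2
  have hA := (Real.Gamma_pos_of_pos (s := a.re + 1) (by linarith)).le
  have hB := (Real.Gamma_pos_of_pos (s := b.re + 1) (by linarith)).le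
  simp only [Pi.add_apply, e3]
  rw [norm_mul]
  refine (mul_le_mul h1 h2 (norm_nonneg _) (by positivity)).trans ?_
  rw [mul_mul_mul_comm]
  refine mul_le_mul_of_nonneg_left ?_ (mul_nonneg hA hB)
  rw [← inv_pow, ← inv_pow]
  nlinarith [sq_nonneg (‖a + y * I‖⁻¹ - ‖b - y * I‖⁻¹), sq_nonneg ‖a + y * I‖⁻¹,
    sq_nonneg ‖b - y * I‖⁻¹]

/-- The Mellin–Barnes integral for `(1 + x) ^ (-u)`. -/
theorem integral_Gamma_mul_Gamma_mul_cpow {u : ℂ} {c x : ℝ} (hc : c < 0) (huc : -u.re < c)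
    (hx : 0 < x) :
    ∫ y : ℝ, Complex.Gamma (u + (c + y * I)) / Complex.Gamma u * Complex.Gamma (-(c + y * I)) *
      (x : ℂ) ^ (c + y * I) = 2 * π * ((1 + x : ℝ) : ℂ) ^ (-u) := by
  have hmel (y : ℝ) := hasMellin_one_add_cpow_neg (u := u) (s := (-c : ℝ) + y * I)
    (by simpa using hc) (by simp; linarith)
  have hvert : VerticalIntegrable (mellin fun x : ℝ ↦ ((1 + x : ℝ) : ℂ) ^ (-u)) (-c) := by
    simp only [VerticalIntegrable, (hmel _).2]
    have := integrable_Gamma_mul_Gamma (a := -c) (b := u + c) (by simpa using hc)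
      (by simp; linarith)
    refine (this.div_const (Complex.Gamma u)).congr (.of_forall fun y ↦ ?_)
    simp only
    congr 3
    · push_cast; ring
    · push_cast; ring
  have hinv := mellinInv_mellin_eq (-c) (fun x : ℝ ↦ ((1 + x : ℝ) : ℂ) ^ (-u)) hx
    (by simpa using (hmel 0).1) hvert
    (by
      refine ContinuousAt.cpow (by fun_prop) (by fun_prop) ?_
      exact ofReal_mem_slitPlane.2 (by positivity))
  simp only [mellinInv, (hmel _).2] at hinv
  rw [← hinv, ← integral_neg_eq_self]
  have hpi : (2 * π : ℂ) ≠ 0 := by simp [Real.pi_ne_zero]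
  rw [real_smul]
  push_cast
  rw [one_div, mul_inv_cancel_left₀ hpi]
  refine integral_congr_ae (.of_forall fun y ↦ ?_)
  simp only [smul_eq_mul]
  rw [show (c + -(y : ℂ) * I : ℂ) = -(-c + y * I) by ring, neg_neg, ← sub_eq_add_neg]
  ring

theorem integral_Gamma_mul_Gamma_mul_cpow_mul_cpow {u : ℂ} (v : ℂ) {c a b : ℝ} (hc : c < 0)
    (huc : -u.re < c) (ha : 0 < a) (hb : 0 < b) :
    ∫ y : ℝ, Complex.Gamma (u + (c + y * I)) / Complex.Gamma u * Complex.Gamma (-(c + y * I)) *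
      ((b : ℂ) ^ (c + y * I) * (a : ℂ) ^ (-(u + v + (c + y * I)))) =
    2 * π * ((a : ℂ) ^ (-v) * ((a + b : ℝ) : ℂ) ^ (-u)) := by
  have h := integral_Gamma_mul_Gamma_mul_cpow hc huc (div_pos hb ha)
  have e : a + b = a * (1 + b / a) := by field_simp
  have hpos : 0 < 1 + b / a := by positivity
  rw [e, ofReal_mul, mul_cpow_ofReal_nonneg ha.le hpos.le]
  rw [show 2 * (π : ℂ) * ((a : ℂ) ^ (-v) * ((a : ℂ) ^ (-u) * ((1 + b / a : ℝ) : ℂ) ^ (-u))) =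
    (a : ℂ) ^ (-v) * (a : ℂ) ^ (-u) * (2 * π * ((1 + b / a : ℝ) : ℂ) ^ (-u)) by ring, ← h,
    ← integral_const_mul]
  refine integral_congr_ae (.of_forall fun y ↦ ?_)
  simp only
  rw [mul_left_comm ((a : ℂ) ^ (-v) * (a : ℂ) ^ (-u))]
  refine congrArg _ ?_
  simp only [ofReal_cpow_eq_exp ha, ofReal_cpow_eq_exp hb, ofReal_cpow_eq_exp (div_pos hb ha),
    Real.log_div hb.ne' ha.ne', ← Complex.exp_add]
  congr 1
  push_cast
  ring

theorem summable_nat_add_one_add_rpow {α p : ℝ} (hα : 0 ≤ α) (hp : p < -1) :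
    Summable fun n : ℕ ↦ ((n : ℝ) + 1 + α) ^ p := by
  have h := (summable_nat_add_iff 1).2 (Real.summable_nat_rpow.2 hp)
  refine h.of_nonneg_of_le (fun n ↦ by positivity) fun n ↦ ?_
  push_cast
  exact Real.rpow_le_rpow_of_nonpos (by positivity) (by linarith) (by linarith)

theorem stmt_1 (u v : ℂ) (α c : ℝ) (hu : 1 < u.re) (huv : 2 < (u + v).re) (hα : 0 ≤ α)
    (hc : max (-u.re) (1 - (u + v).re) < c) (hc1 : c < -1) :
    fSum u v α = (1 / (2 * π)) * ∫ y : ℝ,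
      (Complex.Gamma (u + (c + y * Complex.I)) / Complex.Gamma u) *
        Complex.Gamma (-(c + y * Complex.I)) * riemannZeta (-(c + y * Complex.I)) *
        zeta1 (u + v + (c + y * Complex.I)) α := by
  obtain ⟨hcu, hcuv⟩ := max_lt_iff.1 hc
  have hc0 : c < 0 := by linarith
  set G : ℝ → ℂ := fun y ↦
    Complex.Gamma (u + (c + y * I)) / Complex.Gamma u * Complex.Gamma (-(c + y * I)) with hG
  set A : ℕ → ℝ := fun n ↦ n + 1 + α with hA
  set B : ℕ → ℝ := fun m ↦ m + 1 with hB
  have hApos (n : ℕ) : 0 < A n := by positivity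
  have hBpos (m : ℕ) : 0 < B m := by positivity
  set q : ℝ := -((u + v).re + c) with hq
  have hGint : Integrable G := by
    have := integrable_Gamma_mul_Gamma (a := u + c) (b := -c) (by simp; linarith)
      (by simpa using hc0)
    refine (this.div_const (Complex.Gamma u)).congr (.of_forall fun y ↦ ?_)
    simp only [hG, neg_add', add_assoc]
    ring
  let F : ℕ × ℕ → ℝ → ℂ := fun i y ↦
    G y * ((B i.2 : ℂ) ^ (c + y * I) * (A i.1 : ℂ) ^ (-(u + v + (c + y * I))))
  have hnormA (n : ℕ) (y : ℝ) : ‖(A n : ℂ) ^ (-(u + v + (c + y * I)))‖ = A n ^ q := by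
    rw [norm_cpow_eq_rpow_re_of_pos (hApos n)]
    simp [hq]
  have hnormB (m : ℕ) (y : ℝ) : ‖(B m : ℂ) ^ (c + y * I)‖ = B m ^ c := by
    rw [norm_cpow_eq_rpow_re_of_pos (hBpos m)]
    simp
  have hnormF (i : ℕ × ℕ) (y : ℝ) : ‖F i y‖ = ‖G y‖ * (A i.1 ^ q * B i.2 ^ c) := by
    simp only [F, norm_mul, hnormA, hnormB, mul_comm (A i.1 ^ q)]
  have hsumA : Summable fun n ↦ A n ^ q :=
    summable_nat_add_one_add_rpow hα (by linarith)
  have hsumB : Summable fun m ↦ B m ^ c := by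
    simpa using summable_nat_add_one_add_rpow le_rfl hc1
  have hFint (i : ℕ × ℕ) : Integrable (F i) := by
    refine (hGint.norm.mul_const (A i.1 ^ q * B i.2 ^ c)).mono' ?_
      (.of_forall fun y ↦ (hnormF i y).le)
    refine hGint.aestronglyMeasurable.mul (Continuous.aestronglyMeasurable ?_)
    simp only [ofReal_cpow_eq_exp (hApos _), ofReal_cpow_eq_exp (hBpos _)]
    fun_prop
  have hFsum : Summable fun i ↦ ∫ y, ‖F i y‖ := by
    simp only [hnormF, integral_mul_const]
    exact (hsumA.mul_of_nonneg hsumB (fun n ↦ (Real.rpow_pos_of_pos (hApos n) _).le)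
      (fun m ↦ (Real.rpow_pos_of_pos (hBpos m) _).le)).mul_left _
  have hsum := hasSum_integral_of_summable_integral_norm hFint hFsum
  have hzeta (y : ℝ) : ∑' i, F i y =
      G y * riemannZeta (-(c + y * I)) * zeta1 (u + v + (c + y * I)) α := by
    have hz : riemannZeta (-(c + y * I)) = ∑' m, (B m : ℂ) ^ (c + y * I) := by
      rw [zeta_eq_tsum_one_div_nat_add_one_cpow (by simp; linarith)]
      refine tsum_congr fun m ↦ ?_
      rw [cpow_neg, one_div, inv_inv]
      simp [hB]
    have hz1 : zeta1 (u + v + (c + y * I)) α = ∑' n, (A n : ℂ) ^ (-(u + v + (c + y * I))) := by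
      simp [zeta1, hA]
    rw [hz, hz1, mul_assoc, mul_comm (∑' m, (B m : ℂ) ^ _),
      tsum_mul_tsum_of_summable_norm (by simpa only [hnormA] using hsumA)
        (by simpa only [hnormB] using hsumB), ← tsum_mul_left]
    exact tsum_congr fun i ↦ congrArg (G y * ·) (mul_comm _ _)
  simp only [hzeta] at hsum
  have hterm (i : ℕ × ℕ) : ∫ y, F i y =
      2 * π * ((A i.1 : ℂ) ^ (-v) * ((A i.1 + B i.2 : ℝ) : ℂ) ^ (-u)) :=
    integral_Gamma_mul_Gamma_mul_cpow_mul_cpow v hc0 hcu (hApos _) (hBpos _)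
  have hpi : (2 * π : ℂ) ≠ 0 := by simp [Real.pi_ne_zero]
  rw [← hsum.tsum_eq, hsum.summable.tsum_prod, fSum]
  simp only [hterm, tsum_mul_left]
  rw [one_div, inv_mul_cancel_left₀ hpi]
  refine tsum_congr fun n ↦ ?_
  congr 2
  · simp [hA]
  · ext m
    congr 1
    simp only [hA, hB]
    push_cast
    ring
end

section
/- Fix σ ∈ (0,1) and write s = σ + it. With N = ⌊√(t/(2π))⌋, as t → ∞ one has ∫₀¹ B_N(α) ∑_{n=1}^N (n+α)^{−s} dα = O(t^{−σ/2} log t) and χ(s) ∫₀¹ B_N(−α) ∑_{n=1}^N (n+α)^{s−1} dα = O(t^{−σ/2} log t). -/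
open Complex MeasureTheory Real Filter Asymptotics

/-- The Dirichlet-type kernel `B_N(α) = ∑_{n=1}^N e^{2πinα}`. -/
noncomputable def BKer (N : ℕ) (α : ℝ) : ℂ :=
  ∑ n ∈ Finset.range N, Complex.exp (2 * π * Complex.I * ((n : ℂ) + 1) * (α : ℂ))

/-- The factor `χ(s) = 2^{s-1} π^s sin(πs/2) Γ(1-s)` of the functional equation. -/
noncomputable def chi (s : ℂ) : ℂ :=
  2 ^ (s - 1) * (π : ℂ) ^ s * Complex.sin (π * s / 2) * Complex.Gamma (1 - s)

/-- First derivative test for the phase `c x - t log x` when it has no stationary point in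
`[a, b]`. -/
theorem norm_integral_exp_mul_cpow_le {a b σ c t : ℝ} (ha : 0 < a) (hab : a ≤ b) (hσ : σ ≤ 1)
    (hc : 0 ≤ c) (ht : c * b < t) :
    ‖∫ x in a..b, cexp (I * c * x) * (x : ℂ) ^ (-(σ + t * I))‖ ≤
      2 * (b ^ (1 - σ) / (t - c * b)) := by
  set h : ℝ → ℂ := fun x => cexp (I * c * x) * (x : ℂ) ^ (-(σ + t * I)) with hh
  set G : ℝ → ℂ := fun x => I * cexp (I * c * x) * (x : ℂ) ^ (1 - (σ + t * I)) / (t - c * x) with hG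
  set v : ℝ → ℝ := fun x => x ^ (1 - σ) / (t - c * x) with hv
  set v' : ℝ → ℝ := fun x => x ^ (-σ) * ((1 - σ) / (t - c * x) + c * x / (t - c * x) ^ 2) with hv'
  set r : ℝ → ℂ := fun x => I * h x * ((1 - σ) / (t - c * x) + c * x / (t - c * x) ^ 2) with hr
  have hpos : ∀ x ∈ Set.Icc a b, 0 < x ∧ 0 < t - c * x := by
    rintro x ⟨hx1, hx2⟩
    exact ⟨by linarith, by nlinarith⟩
  have hne : ∀ x ∈ Set.Icc a b, (t - c * x : ℂ) ≠ 0 := by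
    intro x hx
    exact_mod_cast (hpos x hx).2.ne'
  have hslit : ∀ x ∈ Set.Icc a b, (x : ℂ) ∈ slitPlane := by
    intro x hx
    exact Complex.ofReal_mem_slitPlane.2 (hpos x hx).1
  have hcont : ContinuousOn h (Set.Icc a b) := by
    refine ContinuousOn.mul (by fun_prop) ?_
    exact ContinuousOn.cpow (by fun_prop) (by fun_prop) hslit
  have hcontr : ContinuousOn r (Set.Icc a b) := by
    refine ContinuousOn.mul (continuousOn_const.mul hcont) (ContinuousOn.add ?_ ?_)
    · exact ContinuousOn.div (by fun_prop) (by fun_prop) hne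
    · exact ContinuousOn.div (by fun_prop) (by fun_prop) fun x hx => pow_ne_zero _ (hne x hx)
  have hcontv : ContinuousOn v' (Set.Icc a b) := by
    refine ContinuousOn.mul ?_ (ContinuousOn.add ?_ ?_)
    · exact ContinuousOn.rpow_const (by fun_prop) fun x hx => Or.inl (hpos x hx).1.ne'
    · exact ContinuousOn.div (by fun_prop) (by fun_prop) fun x hx => (hpos x hx).2.ne'
    · exact ContinuousOn.div (by fun_prop) (by fun_prop)
        fun x hx => pow_ne_zero _ (hpos x hx).2.ne'
  have hi := hcont.intervalIntegrable_of_Icc (μ := volume) hab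
  have hir := hcontr.intervalIntegrable_of_Icc (μ := volume) hab
  have hiv := hcontv.intervalIntegrable_of_Icc (μ := volume) hab
  have hderiv : ∀ x ∈ Set.uIcc a b, HasDerivAt G (h x + r x) x := by
    rw [Set.uIcc_of_le hab]
    intro x hx
    have hx0 : (x : ℂ) ≠ 0 := by exact_mod_cast (hpos x hx).1.ne'
    have hid : HasDerivAt (fun y : ℝ => (y : ℂ)) 1 x := Complex.ofRealCLM.hasDerivAt
    have h1 : HasDerivAt (fun y : ℝ => I * cexp (I * c * y))
        (I * (cexp (I * c * x) * (I * c * 1))) x :=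
      ((hid.const_mul (I * c)).cexp).const_mul I
    have h2 : HasDerivAt (fun y : ℝ => (y : ℂ) ^ (1 - (σ + t * I)))
        ((1 - (σ + t * I)) * (x : ℂ) ^ (1 - (σ + t * I) - 1) * 1) x :=
      ((hasDerivAt_id (x : ℂ)).cpow_const (hslit x hx)).comp_ofReal
    have h3 : HasDerivAt (fun y : ℝ => (t - c * y : ℂ)) (-(c * 1)) x :=
      (hid.const_mul (c : ℂ)).const_sub (t : ℂ)
    have h4 := (h1.mul h2).div h3 (hne x hx)
    refine h4.congr_deriv ?_
    have e1 : (x : ℂ) ^ (1 - (σ + t * I)) = x * (x : ℂ) ^ (-(σ + t * I)) := by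
      rw [sub_eq_add_neg, cpow_add _ _ hx0, cpow_one]
    have e2 : (1 - (σ + t * I) - 1 : ℂ) = -(σ + t * I) := by ring
    have hn := hne x hx
    simp only [hr, hh, e1, e2, Pi.mul_apply]
    generalize (x : ℂ) ^ (-(σ + t * I)) = X
    generalize cexp (I * c * x) = E
    field_simp
    ring_nf
    simp only [I_sq]
    ring
  have hderivv : ∀ x ∈ Set.uIcc a b, HasDerivAt v (v' x) x := by
    rw [Set.uIcc_of_le hab]
    intro x hx
    have h2 := Real.hasDerivAt_rpow_const (p := 1 - σ) (Or.inl (hpos x hx).1.ne')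
    have h3 : HasDerivAt (fun y : ℝ => t - c * y) (-(c * 1)) x :=
      ((hasDerivAt_id x).const_mul c).const_sub t
    refine (h2.div h3 (hpos x hx).2.ne').congr_deriv ?_
    have e1 : x ^ (1 - σ) = x * x ^ (-σ) := by
      rw [sub_eq_add_neg, Real.rpow_add (hpos x hx).1, Real.rpow_one]
    have e2 : 1 - σ - 1 = -σ := by ring
    have hn := (hpos x hx).2.ne'
    simp only [hv', e1, e2]
    generalize x ^ (-σ) = X
    field_simp
    ring
  have hI := intervalIntegral.integral_eq_sub_of_hasDerivAt hderiv (hi.add hir)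
  have hIv := intervalIntegral.integral_eq_sub_of_hasDerivAt hderivv hiv
  rw [intervalIntegral.integral_add hi hir] at hI
  have hrv : ‖∫ x in a..b, r x‖ ≤ v b - v a := by
    rw [← hIv]
    refine intervalIntegral.norm_integral_le_of_norm_le hab (ae_of_all _ fun x hx => ?_) hiv
    obtain ⟨hx0, hx1⟩ := hpos x ⟨hx.1.le, hx.2⟩
    have hnh : ‖h x‖ = x ^ (-σ) := by
      simp only [hh, norm_mul, Complex.norm_cpow_eq_rpow_re_of_pos hx0]
      have : ‖cexp (I * c * x)‖ = 1 := by
        rw [Complex.norm_exp]; simp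
      rw [this]; simp
    have hq : 0 ≤ (1 - σ) / (t - c * x) + c * x / (t - c * x) ^ 2 := by
      have := sub_nonneg.2 hσ
      positivity
    have : r x = I * h x * (((1 - σ) / (t - c * x) + c * x / (t - c * x) ^ 2 : ℝ) : ℂ) := by
      simp only [hr]; push_cast; rfl
    rw [this, norm_mul, norm_mul, Complex.norm_I, one_mul, hnh, Complex.norm_real,
      Real.norm_of_nonneg hq]
  have hGn : ∀ x ∈ Set.Icc a b, ‖G x‖ = v x := by
    intro x hx
    obtain ⟨hx0, hx1⟩ := hpos x hx
    have e1 : ‖cexp (I * c * x)‖ = 1 := by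
      rw [Complex.norm_exp]; simp
    have e2 : (t - c * x : ℂ) = ((t - c * x : ℝ) : ℂ) := by push_cast; rfl
    simp only [hG, hv, norm_mul, norm_div, e1, e2, Complex.norm_I,
      Complex.norm_cpow_eq_rpow_re_of_pos hx0, Complex.norm_real, Real.norm_of_nonneg hx1.le]
    simp
  have e : ∫ x in a..b, h x = G b - G a - ∫ x in a..b, r x := by rw [← hI]; ring
  rw [e]
  calc _ ≤ ‖G b‖ + ‖G a‖ + ‖∫ x in a..b, r x‖ :=
        (norm_sub_le _ _).trans (by gcongr; exact norm_sub_le _ _)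
    _ ≤ v b + v a + (v b - v a) := by
        rw [hGn b ⟨hab, le_rfl⟩, hGn a ⟨le_rfl, hab⟩]; gcongr
    _ = 2 * v b := by ring

theorem norm_integral_exp_mul_cpow_le_trivial {a b σ : ℝ} (c t : ℝ) (ha : 0 < a) (hab : a ≤ b)
    (hσ : 0 ≤ σ) :
    ‖∫ x in a..b, cexp (I * c * x) * (x : ℂ) ^ (-(σ + t * I))‖ ≤ a ^ (-σ) * (b - a) := by
  rw [← abs_of_nonneg (sub_nonneg.2 hab)]
  refine intervalIntegral.norm_integral_le_of_norm_le_const fun x hx => ?_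
  rw [Set.uIoc_of_le hab] at hx
  have hx0 : 0 < x := ha.trans hx.1
  have e1 : ‖cexp (I * c * x)‖ = 1 := by
    rw [Complex.norm_exp]; simp
  rw [norm_mul, e1, Complex.norm_cpow_eq_rpow_re_of_pos hx0]
  simpa using Real.rpow_le_rpow_of_nonpos ha hx.1.le (neg_nonpos.2 hσ)

theorem continuousOn_exp_mul_cpow (c s : ℂ) :
    ContinuousOn (fun x : ℝ => cexp (c * x) * (x : ℂ) ^ s) (Set.Ioi 0) :=
  ContinuousOn.mul (by fun_prop)
    (ContinuousOn.cpow (by fun_prop) (by fun_prop) fun _ hx => Complex.ofReal_mem_slitPlane.2 hx)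

theorem intervalIntegrable_exp_mul_cpow (c s : ℂ) {a b : ℝ} (ha : 0 < a) (hb : 0 < b) :
    IntervalIntegrable (fun x : ℝ => cexp (c * x) * (x : ℂ) ^ s) volume a b :=
  ((continuousOn_exp_mul_cpow c s).mono fun _ hx =>
    (lt_min ha hb).trans_le hx.1).intervalIntegrable

theorem integral_BKer_mul_sum_cpow (N : ℕ) (z : ℂ) :
    ∫ α in (0 : ℝ)..1, BKer N α * ∑ n ∈ Finset.range N, (((n : ℂ) + 1) + (α : ℂ)) ^ z =
      ∑ m ∈ Finset.range N, ∫ x in (1 : ℝ)..(N + 1),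
        cexp (I * (2 * π * (m + 1) : ℝ) * x) * (x : ℂ) ^ z := by
  have hshift : ∀ (m n : ℕ) (α : ℝ),
      cexp (2 * π * I * ((m : ℂ) + 1) * α) * (((n : ℂ) + 1) + (α : ℂ)) ^ z =
        cexp (I * (2 * π * (m + 1) : ℝ) * ((n + 1 + α : ℝ) : ℂ)) * ((n + 1 + α : ℝ) : ℂ) ^ z := by
    intro m n α
    have h := Complex.exp_periodic.nat_mul ((m + 1) * (n + 1)) (2 * π * I * ((m : ℂ) + 1) * α)
    rw [← h]
    push_cast
    ring_nf
  have hint : ∀ m n : ℕ, IntervalIntegrable (fun α : ℝ =>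
      cexp (2 * π * I * ((m : ℂ) + 1) * α) * (((n : ℂ) + 1) + (α : ℂ)) ^ z) volume 0 1 := by
    intro m n
    refine ContinuousOn.intervalIntegrable_of_Icc zero_le_one
      (ContinuousOn.mul (by fun_prop) (ContinuousOn.cpow (by fun_prop) (by fun_prop) ?_))
    intro x hx
    have : 0 < (n : ℝ) + 1 + x := by have := hx.1; positivity
    exact_mod_cast Complex.ofReal_mem_slitPlane.2 this
  simp only [BKer, Finset.sum_mul_sum]
  rw [intervalIntegral.integral_finsetSum fun m _ => by
    simpa only [Finset.sum_fn] using
      IntervalIntegrable.sum (Finset.range N) fun n _ => hint m n]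
  refine Finset.sum_congr rfl fun m _ => ?_
  rw [intervalIntegral.integral_finsetSum fun n _ => hint m n]
  have hadj := intervalIntegral.sum_integral_adjacent_intervals (a := fun n : ℕ => (n + 1 : ℝ))
    (n := N) (μ := volume)
    fun n _ => intervalIntegrable_exp_mul_cpow (I * (2 * π * (m + 1) : ℝ)) z
      (a := (n : ℝ) + 1) (b := ((n + 1 : ℕ) : ℝ) + 1) (by positivity) (by positivity)
  simp only [Nat.cast_zero, zero_add] at hadj
  rw [← hadj]
  refine Finset.sum_congr rfl fun n _ => ?_
  simp only [hshift]
  rw [intervalIntegral.integral_comp_add_left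
    (fun x : ℝ => cexp (I * (2 * π * (m + 1) : ℝ) * x) * (x : ℂ) ^ z)]
  push_cast
  simp

theorem integral_BKer_neg_mul_sum_cpow (N : ℕ) (z : ℂ) :
    ∫ α in (0 : ℝ)..1, BKer N (-α) * ∑ n ∈ Finset.range N, (((n : ℂ) + 1) + (α : ℂ)) ^ z =
      (starRingEnd ℂ) (∫ α in (0 : ℝ)..1, BKer N α *
        ∑ n ∈ Finset.range N, (((n : ℂ) + 1) + (α : ℂ)) ^ ((starRingEnd ℂ) z)) := by
  rw [← intervalIntegral.intervalIntegral_conj]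
  refine intervalIntegral.integral_congr fun α hα => ?_
  rw [Set.uIcc_of_le zero_le_one] at hα
  simp only [BKer, map_mul, map_sum, ← Complex.exp_conj]
  congr 1
  · refine Finset.sum_congr rfl fun n _ => ?_
    simp [map_ofNat]
  · refine Finset.sum_congr rfl fun n _ => ?_
    have h0 : 0 ≤ (n : ℝ) + 1 + α := by have := hα.1; positivity
    have harg : ((n : ℂ) + 1 + α).arg ≠ π := by
      have := Complex.arg_ofReal_of_nonneg h0
      push_cast at this
      rw [this]
      exact Real.pi_pos.ne
    rw [Complex.cpow_conj _ _ harg]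
    simp

theorem norm_integral_exp_mul_cpow_le_of_add_two_le {σ t : ℝ} {N m k : ℕ} (hσ1 : σ ≤ 1)
    (ht : 2 * π * (N : ℝ) ^ 2 ≤ t) (hk : 1 ≤ k) (hm : m + k + 1 = N) :
    ‖∫ x in (1 : ℝ)..(N + 1), cexp (I * (2 * π * m : ℝ) * x) * (x : ℂ) ^ (-(σ + t * I))‖ ≤
      ((N : ℝ) + 1) ^ (-σ) * (1 / k) := by
  have hN0 : (0 : ℝ) ≤ N := N.cast_nonneg
  have hk1 : (1 : ℝ) ≤ k := by exact_mod_cast hk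
  have hmr : (m : ℝ) = N - k - 1 := by rw [← hm]; push_cast; ring
  have hkey : 2 * (((N : ℝ) + 1) * k) ≤ t - 2 * π * m * (N + 1) := by
    have h1 : t - 2 * π * m * (N + 1) ≥ 2 * π * (((N : ℝ) + 1) * k + 1) := by
      rw [hmr]; nlinarith
    nlinarith [Real.pi_gt_three, mul_nonneg hN0 (zero_le_one.trans hk1)]
  have hp : 0 < 2 * (((N : ℝ) + 1) * k) := by positivity
  refine (norm_integral_exp_mul_cpow_le one_pos (by linarith) hσ1 (by positivity)
    (by linarith)).trans ?_
  calc _ ≤ 2 * (((N : ℝ) + 1) ^ (1 - σ) / (2 * ((N + 1) * k))) := by gcongr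
    _ = _ := by
      rw [sub_eq_add_neg, Real.rpow_add (by positivity), Real.rpow_one]
      field_simp

theorem norm_integral_exp_mul_cpow_le_of_le {σ t : ℝ} {N m : ℕ} (hσ0 : 0 ≤ σ) (hσ1 : σ ≤ 1)
    (ht : 2 * π * (N : ℝ) ^ 2 ≤ t) (hN : 2 ≤ N) (hm : m ≤ N) :
    ‖∫ x in (1 : ℝ)..(N + 1), cexp (I * (2 * π * m : ℝ) * x) * (x : ℂ) ^ (-(σ + t * I))‖ ≤
      5 * (N : ℝ) ^ (-σ) := by
  have hN2 : (2 : ℝ) ≤ N := by exact_mod_cast hN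
  have hmr : (m : ℝ) ≤ N := by exact_mod_cast hm
  have hkey : 2 * (N : ℝ) ≤ t - 2 * π * m * (N - 1) := by
    have h1 : t - 2 * π * m * (N - 1) ≥ 2 * π * N := by
      have : 2 * π * m * (N - 1) ≤ 2 * π * N * (N - 1) := by
        have : (0 : ℝ) ≤ N - 1 := by linarith
        gcongr
      nlinarith
    nlinarith [Real.pi_gt_three]
  rw [← intervalIntegral.integral_add_adjacent_intervals (b := (N : ℝ) - 1)
    (intervalIntegrable_exp_mul_cpow _ _ (by linarith) (by linarith))
    (intervalIntegrable_exp_mul_cpow _ _ (by linarith) (by linarith))]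
  have h1 : ‖∫ x in (1 : ℝ)..(N - 1), cexp (I * (2 * π * m : ℝ) * x) * (x : ℂ) ^ (-(σ + t * I))‖ ≤
      (N : ℝ) ^ (-σ) := by
    refine (norm_integral_exp_mul_cpow_le one_pos (by linarith) hσ1 (by positivity)
      (by linarith)).trans ?_
    calc _ ≤ 2 * ((N : ℝ) ^ (1 - σ) / (2 * N)) := by
          gcongr
          · linarith
          · linarith
      _ = _ := by
        rw [sub_eq_add_neg, Real.rpow_add (by positivity), Real.rpow_one]
        field_simp
  have h2 : ((N : ℝ) - 1) ^ (-σ) ≤ 2 * (N : ℝ) ^ (-σ) := by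
    calc ((N : ℝ) - 1) ^ (-σ) ≤ ((N : ℝ) / 2) ^ (-σ) :=
          Real.rpow_le_rpow_of_nonpos (by linarith) (by linarith) (by linarith)
      _ = 2 ^ σ * (N : ℝ) ^ (-σ) := by
          rw [Real.div_rpow (by positivity) zero_le_two, Real.rpow_neg zero_le_two, div_inv_eq_mul,
            mul_comm]
      _ ≤ 2 ^ (1 : ℝ) * (N : ℝ) ^ (-σ) := by
          gcongr
          exact one_le_two
      _ = _ := by rw [Real.rpow_one]
  have h3 := norm_integral_exp_mul_cpow_le_trivial (a := (N : ℝ) - 1) (b := N + 1)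
    (2 * π * m) t (by linarith) (by linarith) hσ0
  refine (norm_add_le _ _).trans ?_
  linarith

theorem norm_sum_integral_exp_mul_cpow_le {σ t : ℝ} {N : ℕ} (hσ0 : 0 ≤ σ) (hσ1 : σ ≤ 1)
    (ht : 2 * π * (N : ℝ) ^ 2 ≤ t) (hN : 2 ≤ N) :
    ‖∑ m ∈ Finset.range N, ∫ x in (1 : ℝ)..(N + 1),
        cexp (I * (2 * π * (m + 1) : ℝ) * x) * (x : ℂ) ^ (-(σ + t * I))‖ ≤
      (N : ℝ) ^ (-σ) * (11 + Real.log N) := by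
  obtain ⟨K, rfl⟩ := Nat.exists_eq_add_of_le' hN
  have hN0 : (0 : ℝ) < (K + 2 : ℕ) := by positivity
  set F : ℕ → ℂ := fun m => ∫ x in (1 : ℝ)..((K + 2 : ℕ) + 1),
        cexp (I * (2 * π * (m + 1) : ℝ) * x) * (x : ℂ) ^ (-(σ + t * I))
  have hlast : ∀ m, m + 1 ≤ K + 2 → ‖F m‖ ≤ 5 * ((K + 2 : ℕ) : ℝ) ^ (-σ) := by
    intro m hm
    simpa [F] using norm_integral_exp_mul_cpow_le_of_le hσ0 hσ1 ht hN hm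
  have hmain : ‖∑ m ∈ Finset.range K, F m‖ ≤
      ((K + 2 : ℕ) : ℝ) ^ (-σ) * (1 + Real.log (K + 2 : ℕ)) := by
    rw [← Finset.sum_range_reflect]
    calc _ ≤ ∑ j ∈ Finset.range K, ((K + 2 : ℕ) : ℝ) ^ (-σ) * (1 / ((j + 1 : ℕ) : ℝ)) := by
          refine norm_sum_le_of_le _ fun j hj => ?_
          rw [Finset.mem_range] at hj
          have h := norm_integral_exp_mul_cpow_le_of_add_two_le (m := K - 1 - j + 1) (k := j + 1) hσ1 ht
            (by omega) (by omega)
          have hF : ‖F (K - 1 - j)‖ ≤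
              (((K + 2 : ℕ) : ℝ) + 1) ^ (-σ) * (1 / ((j + 1 : ℕ) : ℝ)) := by
            simpa [F] using h
          refine hF.trans (mul_le_mul_of_nonneg_right ?_ (by positivity))
          exact Real.rpow_le_rpow_of_nonpos hN0 (by linarith) (by linarith)
      _ = ((K + 2 : ℕ) : ℝ) ^ (-σ) * (harmonic K : ℝ) := by
          rw [← Finset.mul_sum, harmonic]
          simp
      _ ≤ _ := by
          gcongr
          refine (harmonic_le_one_add_log K).trans ?_
          rcases Nat.eq_zero_or_pos K with rfl | hK
          · simpa using Real.log_nonneg (one_le_two (α := ℝ))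
          · gcongr
            omega
  rw [Finset.sum_range_succ, Finset.sum_range_succ]
  have h1 := hlast K (by omega)
  have h2 := hlast (K + 1) (by omega)
  have h3 := norm_add₃_le (a := ∑ m ∈ Finset.range K, F m) (b := F K) (c := F (K + 1))
  refine h3.trans ?_
  linarith

theorem eventually_norm_integral_BKer_mul_sum_le {σ : ℝ} (hσ0 : 0 ≤ σ) (hσ1 : σ ≤ 1) :
    ∀ᶠ t : ℝ in atTop, ‖∫ α in (0 : ℝ)..1, BKer ⌊√(t / (2 * π))⌋₊ α *
      ∑ n ∈ Finset.range ⌊√(t / (2 * π))⌋₊, (((n : ℂ) + 1) + (α : ℂ)) ^ (-(σ + t * I))‖ ≤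
        96 * (t ^ (-σ / 2) * Real.log t) := by
  filter_upwards [eventually_ge_atTop 100] with t ht
  have ht0 : 0 < t := by linarith
  have hπ3 := Real.pi_gt_three
  have hπ4 := Real.pi_lt_four
  have hx0 : 0 ≤ t / (2 * π) := by positivity
  have hx2 : 2 ≤ √(t / (2 * π)) := by
    refine Real.le_sqrt_of_sq_le ?_
    rw [le_div_iff₀ (by positivity)]
    linarith
  have hxt : √t / 4 ≤ √(t / (2 * π)) := by
    refine Real.le_sqrt_of_sq_le ?_
    rw [div_pow, Real.sq_sqrt ht0.le]
    gcongr
    linarith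
  have hle := Nat.floor_le (Real.sqrt_nonneg (t / (2 * π)))
  have hlt := Nat.lt_floor_add_one √(t / (2 * π))
  have hN : 2 ≤ ⌊√(t / (2 * π))⌋₊ := Nat.le_floor (by exact_mod_cast hx2)
  rw [integral_BKer_mul_sum_cpow]
  generalize ⌊√(t / (2 * π))⌋₊ = N at *
  have hsq : (N : ℝ) ^ 2 ≤ t / (2 * π) := by
    rw [← Real.sq_sqrt hx0]
    gcongr
  have htN : 2 * π * (N : ℝ) ^ 2 ≤ t := by
    rw [le_div_iff₀ (by positivity)] at hsq
    linarith
  have hN2 : (2 : ℝ) ≤ N := by exact_mod_cast hN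
  have hNt : (N : ℝ) ≤ t := by nlinarith
  have hlow : √t / 8 ≤ N := by linarith
  have hst : 0 < √t := Real.sqrt_pos.2 ht0
  have hpow : (N : ℝ) ^ (-σ) ≤ 8 * t ^ (-σ / 2) := by
    calc (N : ℝ) ^ (-σ) ≤ (√t / 8) ^ (-σ) :=
          Real.rpow_le_rpow_of_nonpos (by positivity) hlow (by linarith)
      _ = 8 ^ σ * t ^ (-σ / 2) := by
          rw [Real.div_rpow hst.le (by norm_num), Real.rpow_neg (x := 8) (by norm_num), div_inv_eq_mul,
            mul_comm, Real.sqrt_eq_rpow, ← Real.rpow_mul ht0.le]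
          ring_nf
      _ ≤ 8 ^ (1 : ℝ) * t ^ (-σ / 2) := by
          gcongr
          norm_num
      _ = _ := by rw [Real.rpow_one]
  have hlog : Real.log N ≤ Real.log t := by gcongr
  have hlog1 : 1 ≤ Real.log t := by
    rw [Real.le_log_iff_exp_le ht0]
    linarith [Real.exp_one_lt_d9]
  calc _ ≤ (N : ℝ) ^ (-σ) * (11 + Real.log N) := norm_sum_integral_exp_mul_cpow_le hσ0 hσ1 htN hN
    _ ≤ (8 * t ^ (-σ / 2)) * (12 * Real.log t) := by
        gcongr
        linarith
    _ = _ := by ring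

theorem rpow_mul_rpow_le_mul_exp {a x t : ℝ} (ha0 : 0 ≤ a) (ha1 : a ≤ 1) (hx : 0 ≤ x)
    (ht : 1 ≤ t) :
    (x ^ 2 + t ^ 2) ^ (1 - a) * ((x + 1) ^ 2 + t ^ 2) ^ a ≤
      ((x + a) ^ 2 + t ^ 2) * Real.exp (1 / (x ^ 2 + 1)) := by
  have h1 := Real.geom_mean_le_arith_mean2_weighted (sub_nonneg.2 ha1) ha0
    (by positivity : 0 ≤ x ^ 2 + t ^ 2) (by positivity : 0 ≤ (x + 1) ^ 2 + t ^ 2) (by ring)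
  refine h1.trans ?_
  have h2 := Real.add_one_le_exp (1 / (x ^ 2 + 1))
  have h3 : (1 : ℝ) ≤ ((x + a) ^ 2 + t ^ 2) * (1 / (x ^ 2 + 1)) := by
    rw [mul_one_div, le_div_iff₀ (by positivity)]
    nlinarith [mul_nonneg hx ha0, sq_nonneg a]
  have h4 : a * (1 - a) ≤ 1 := by nlinarith
  calc _ = ((x + a) ^ 2 + t ^ 2) + a * (1 - a) := by ring
    _ ≤ ((x + a) ^ 2 + t ^ 2) * (1 / (x ^ 2 + 1) + 1) := by linarith
    _ ≤ _ := by gcongr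

theorem norm_sq_GammaSeq (a t : ℝ) {n : ℕ} (hn : 0 < n) :
    ‖Complex.GammaSeq (a + t * I) n‖ ^ 2 =
      ((n : ℝ) ^ a * n.factorial) ^ 2 / ∏ j ∈ Finset.range (n + 1), ((j + a) ^ 2 + t ^ 2) := by
  have h : ∀ j : ℕ, ‖(a + t * I + j : ℂ)‖ ^ 2 = (j + a) ^ 2 + t ^ 2 := by
    intro j
    rw [← Complex.normSq_eq_norm_sq, Complex.normSq_apply]
    simp
    ring
  rw [Complex.GammaSeq, norm_div, norm_mul, norm_prod, div_pow, ← Finset.prod_pow,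
    Complex.norm_natCast_cpow_of_pos hn]
  simp [h]

theorem norm_sq_GammaSeq_le {a t : ℝ} (ha0 : 0 ≤ a) (ha1 : a ≤ 1) (ht : 1 ≤ t) {n : ℕ}
    (hn : 0 < n) :
    ‖Complex.GammaSeq (a + t * I) n‖ ^ 2 ≤
      (‖Complex.GammaSeq ((0 : ℝ) + t * I) n‖ ^ 2) ^ (1 - a) *
        (‖Complex.GammaSeq ((1 : ℝ) + t * I) n‖ ^ 2) ^ a *
          Real.exp (∑' k : ℕ, 1 / ((k : ℝ) ^ 2 + 1)) := by
  have hn' : (0 : ℝ) < n := by exact_mod_cast hn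
  have hP : ∀ b : ℝ, 0 ≤ b → 0 < ∏ j ∈ Finset.range (n + 1), (((j : ℝ) + b) ^ 2 + t ^ 2) :=
    fun b hb => Finset.prod_pos fun j _ => by positivity
  rw [norm_sq_GammaSeq _ _ hn, norm_sq_GammaSeq _ _ hn, norm_sq_GammaSeq _ _ hn]
  rw [Real.div_rpow (by positivity) (hP 0 le_rfl).le,
    Real.div_rpow (by positivity) (hP 1 zero_le_one).le,
    div_mul_div_comm, div_mul_eq_mul_div,
    div_le_div_iff₀ (hP a ha0) (mul_pos (Real.rpow_pos_of_pos (hP 0 le_rfl) _)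
      (Real.rpow_pos_of_pos (hP 1 zero_le_one) _))]
  have hnum : (((n : ℝ) ^ (0 : ℝ) * n.factorial) ^ 2) ^ (1 - a) *
      (((n : ℝ) ^ (1 : ℝ) * n.factorial) ^ 2) ^ a = ((n : ℝ) ^ a * n.factorial) ^ 2 := by
    rw [Real.rpow_zero, Real.rpow_one, one_mul, mul_pow, mul_pow,
      Real.mul_rpow (by positivity) (by positivity), mul_left_comm,
      ← Real.rpow_add (by positivity), sub_add_cancel, Real.rpow_one, ← Real.rpow_natCast_mul hn'.le,
      ← Real.rpow_mul_natCast hn'.le, mul_comm a]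
  have hsum : Summable fun k : ℕ => 1 / ((k : ℝ) ^ 2 + 1) := by
    refine Summable.of_norm_bounded_eventually_nat (g := fun k : ℕ => 1 / (k : ℝ) ^ 2)
      (Real.summable_one_div_nat_pow.2 one_lt_two) ?_
    filter_upwards [eventually_gt_atTop 0] with k hk
    have : (0 : ℝ) < k := by exact_mod_cast hk
    rw [Real.norm_of_nonneg (by positivity)]
    gcongr
    linarith
  rw [hnum, mul_assoc]
  refine mul_le_mul_of_nonneg_left ?_ (by positivity)
  rw [← Real.finsetProd_rpow _ _ (fun j _ => by positivity),
    ← Real.finsetProd_rpow _ _ (fun j _ => by positivity), ← Finset.prod_mul_distrib]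
  calc _ ≤ ∏ j ∈ Finset.range (n + 1),
        ((((j : ℝ) + a) ^ 2 + t ^ 2) * Real.exp (1 / ((j : ℝ) ^ 2 + 1))) := by
        refine Finset.prod_le_prod (fun j _ => by positivity) fun j _ => ?_
        simpa using rpow_mul_rpow_le_mul_exp ha0 ha1 j.cast_nonneg ht
    _ ≤ _ := by
        rw [Finset.prod_mul_distrib, ← Real.exp_sum, mul_comm (Real.exp _)]
        gcongr
        exact hsum.sum_le_tsum _ fun k _ => by positivity

/-- Up to a constant, `σ ↦ ‖Γ(σ + it)‖` is logarithmically convex on `[0, 1]`, uniformly in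
`t ≥ 1`. -/
theorem norm_sq_Gamma_le_interpolate {a t : ℝ} (ha0 : 0 ≤ a) (ha1 : a ≤ 1) (ht : 1 ≤ t) :
    ‖Complex.Gamma (a + t * I)‖ ^ 2 ≤
      (‖Complex.Gamma ((0 : ℝ) + t * I)‖ ^ 2) ^ (1 - a) *
        (‖Complex.Gamma ((1 : ℝ) + t * I)‖ ^ 2) ^ a *
          Real.exp (∑' k : ℕ, 1 / ((k : ℝ) ^ 2 + 1)) := by
  have h (z : ℂ) := ((Complex.GammaSeq_tendsto_Gamma z).norm).pow 2
  refine le_of_tendsto_of_tendsto (h _)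
    ((((h _).rpow_const (Or.inr (sub_nonneg.2 ha1))).mul
      ((h _).rpow_const (Or.inr ha0))).mul_const _) ?_
  filter_upwards [eventually_gt_atTop 0] with n hn
  exact norm_sq_GammaSeq_le ha0 ha1 ht hn

theorem norm_sq_Gamma_mul_I {t : ℝ} (ht : 0 < t) :
    ‖Complex.Gamma ((0 : ℝ) + t * I)‖ ^ 2 = π / (t * Real.sinh (π * t)) ∧
    ‖Complex.Gamma ((1 : ℝ) + t * I)‖ ^ 2 = t ^ 2 * ‖Complex.Gamma ((0 : ℝ) + t * I)‖ ^ 2 := by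
  have h0 : (t * I : ℂ) ≠ 0 := by simp [ht.ne']
  have h1 : ‖Complex.Gamma ((1 : ℝ) + t * I)‖ = t * ‖Complex.Gamma (t * I)‖ := by
    have := Complex.Gamma_add_one _ h0
    rw [Complex.ofReal_one, add_comm, this, norm_mul]
    simp [abs_of_pos ht]
  have h2 : ‖Complex.Gamma (1 - t * I)‖ = ‖Complex.Gamma ((1 : ℝ) + t * I)‖ := by
    rw [← Complex.norm_conj, ← Complex.Gamma_conj]
    simp
  have h3 := congrArg norm (Complex.Gamma_mul_Gamma_one_sub (t * I))
  have hs : 0 < Real.sinh (π * t) := Real.sinh_pos_iff.2 (by positivity)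
  rw [norm_mul, h2, h1, norm_div, ← mul_assoc, ← mul_assoc (π : ℂ), Complex.sin_mul_I, norm_mul,
    Complex.norm_I, mul_one,
    ← Complex.ofReal_mul, ← Complex.ofReal_sinh, Complex.norm_real, Complex.norm_real,
    Real.norm_of_nonneg hs.le, Real.norm_of_nonneg Real.pi_pos.le] at h3
  simp only [Complex.ofReal_zero, zero_add]
  constructor
  · rw [eq_div_iff hs.ne'] at h3
    rw [eq_div_iff (by positivity)]
    linear_combination h3
  · rw [h1]; ring

theorem exists_norm_Gamma_le {a : ℝ} (ha0 : 0 ≤ a) (ha1 : a ≤ 1) :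
    ∃ C : ℝ, ∀ t : ℝ, 1 ≤ t →
      ‖Complex.Gamma (a + t * I)‖ ≤ C * (t ^ (a - 1 / 2) * Real.exp (-(π * t / 2))) := by
  set S := ∑' k : ℕ, 1 / ((k : ℝ) ^ 2 + 1)
  refine ⟨√(4 * π * Real.exp S), fun t ht => ?_⟩
  have ht0 : 0 < t := by linarith
  obtain ⟨h0, h1⟩ := norm_sq_Gamma_mul_I ht0
  have h := norm_sq_Gamma_le_interpolate ha0 ha1 ht
  rw [h1] at h
  set q := ‖Complex.Gamma ((0 : ℝ) + t * I)‖ ^ 2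
  have hq0 : 0 ≤ q := by positivity
  have hsinh : Real.exp (π * t) / 4 ≤ Real.sinh (π * t) := by
    rw [Real.sinh_eq]
    have h3 : 1 ≤ π * t := by nlinarith [Real.pi_gt_three]
    have h4 := Real.add_one_le_exp (π * t)
    have h5 : Real.exp (-(π * t)) ≤ 1 := Real.exp_le_one_iff.2 (by linarith)
    linarith
  have hq : q ≤ 4 * π * (t⁻¹ * Real.exp (-(π * t))) := by
    rw [h0, Real.exp_neg]
    calc π / (t * Real.sinh (π * t)) ≤ π / (t * (Real.exp (π * t) / 4)) := by gcongr
      _ = _ := by field_simp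
  have e : q ^ (1 - a) * (t ^ 2 * q) ^ a = t ^ (2 * a) * q := by
    rw [Real.mul_rpow (by positivity) hq0, mul_left_comm, ← Real.rpow_add' hq0 (by simp),
      sub_add_cancel, Real.rpow_one, ← Real.rpow_natCast_mul ht0.le]
    norm_num
  rw [e] at h
  refine (pow_le_pow_iff_left₀ (by positivity) (by positivity) two_ne_zero).1 ?_
  rw [mul_pow, Real.sq_sqrt (by positivity), mul_pow, ← Real.exp_nat_mul,
    ← Real.rpow_mul_natCast ht0.le]
  calc _ ≤ _ := h
    _ ≤ t ^ (2 * a) * (4 * π * (t⁻¹ * Real.exp (-(π * t)))) * Real.exp S := by gcongr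
    _ = _ := by
      rw [show (a - 1 / 2) * ((2 : ℕ) : ℝ) = 2 * a + -1 by push_cast; ring, Real.rpow_add ht0,
        Real.rpow_neg_one, show ((2 : ℕ) : ℝ) * -(π * t / 2) = -(π * t) by push_cast; ring]
      ring

theorem Complex.norm_sin_le (z : ℂ) : ‖Complex.sin z‖ ≤ Real.exp |z.im| := by
  rw [Complex.sin, norm_div, norm_mul, Complex.norm_I, mul_one]
  have h1 : ‖cexp (-z * I)‖ ≤ Real.exp |z.im| := by
    rw [Complex.norm_exp]; simpa using le_abs_self _
  have h2 : ‖cexp (z * I)‖ ≤ Real.exp |z.im| := by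
    rw [Complex.norm_exp]; simpa using neg_le_abs _
  have := norm_sub_le (cexp (-z * I)) (cexp (z * I))
  rw [Complex.norm_ofNat]
  linarith

theorem exists_norm_chi_le {σ : ℝ} (hσ0 : 0 ≤ σ) (hσ1 : σ ≤ 1) :
    ∃ C : ℝ, ∀ t : ℝ, 1 ≤ t → ‖chi (σ + t * I)‖ ≤ C * t ^ (1 / 2 - σ) := by
  obtain ⟨C, hC⟩ := exists_norm_Gamma_le (sub_nonneg.2 hσ1) (sub_le_self 1 hσ0)
  refine ⟨2 ^ (σ - 1) * π ^ σ * C, fun t ht => ?_⟩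
  have hG : ‖Complex.Gamma (1 - (σ + t * I))‖ = ‖Complex.Gamma ((1 - σ : ℝ) + t * I)‖ := by
    rw [← Complex.norm_conj, ← Complex.Gamma_conj]
    congr 2
    simp
    ring
  have hs := Complex.norm_sin_le (π * (σ + t * I) / 2)
  have him : (π * (σ + t * I) / 2 : ℂ).im = π * t / 2 := by simp
  rw [him, abs_of_nonneg (by positivity)] at hs
  have h2 : ‖(2 : ℂ) ^ ((σ + t * I : ℂ) - 1)‖ = 2 ^ (σ - 1) := by
    simpa using Complex.norm_cpow_eq_rpow_re_of_pos two_pos ((σ + t * I : ℂ) - 1)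
  have hp : ‖(π : ℂ) ^ (σ + t * I : ℂ)‖ = π ^ σ := by
    simpa using Complex.norm_cpow_eq_rpow_re_of_pos Real.pi_pos (σ + t * I : ℂ)
  rw [chi, norm_mul, norm_mul, norm_mul, hG, h2, hp]
  calc _ ≤ 2 ^ (σ - 1) * π ^ σ * Real.exp (π * t / 2) *
        (C * (t ^ (1 - σ - 1 / 2) * Real.exp (-(π * t / 2)))) := by
        gcongr
        exact hC t ht
    _ = _ := by
        rw [Real.exp_neg, show 1 - σ - 1 / 2 = 1 / 2 - σ by ring]
        field_simp

theorem stmt_7 (σ : ℝ) (hσ0 : 0 < σ) (hσ1 : σ < 1) :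
    ((fun t : ℝ =>
        ∫ α in (0 : ℝ)..1,
          BKer ⌊Real.sqrt (t / (2 * π))⌋₊ α *
            ∑ n ∈ Finset.range ⌊Real.sqrt (t / (2 * π))⌋₊,
              (((n : ℂ) + 1) + (α : ℂ)) ^ (-(σ + t * Complex.I)))
      =O[atTop] fun t : ℝ => t ^ (-σ / 2) * Real.log t) ∧
    ((fun t : ℝ =>
        chi (σ + t * Complex.I) *
          ∫ α in (0 : ℝ)..1,
            BKer ⌊Real.sqrt (t / (2 * π))⌋₊ (-α) *
              ∑ n ∈ Finset.range ⌊Real.sqrt (t / (2 * π))⌋₊,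
                (((n : ℂ) + 1) + (α : ℂ)) ^ ((σ + t * Complex.I) - 1))
      =O[atTop] fun t : ℝ => t ^ (-σ / 2) * Real.log t) := by
  constructor
  · refine IsBigO.of_bound 96 ?_
    filter_upwards [eventually_norm_integral_BKer_mul_sum_le hσ0.le hσ1.le] with t h
    exact h.trans (by gcongr; exact le_abs_self _)
  · obtain ⟨C, hC⟩ := exists_norm_chi_le hσ0.le hσ1.le
    refine IsBigO.of_bound (C * 96) ?_
    filter_upwards [eventually_norm_integral_BKer_mul_sum_le (sub_nonneg.2 hσ1.le) (sub_le_self 1 hσ0.le),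
      eventually_ge_atTop 1] with t h ht
    have ht0 : 0 < t := by linarith
    have hconj : (starRingEnd ℂ) ((σ + t * I) - 1) = -(((1 - σ : ℝ) : ℂ) + t * I) := by
      simp
      ring
    rw [integral_BKer_neg_mul_sum_cpow, hconj, norm_mul, Complex.norm_conj,
      Real.norm_of_nonneg (mul_nonneg (by positivity) (Real.log_nonneg ht))]
    calc _ ≤ (C * t ^ (1 / 2 - σ)) * (96 * (t ^ (-(1 - σ) / 2) * Real.log t)) :=
          mul_le_mul (hC t ht) h (norm_nonneg _) ((norm_nonneg _).trans (hC t ht))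
      _ = C * 96 * (t ^ (1 / 2 - σ) * t ^ (-(1 - σ) / 2) * Real.log t) := by ring
      _ = _ := by
          rw [← Real.rpow_add ht0]
          ring_nf
end

section
/- Let u, v ∈ ℂ with Re u > 1 and Re v > 1. Then ∫₀¹ ζ₁(u,α) ζ₁(v,α) dα = 1/(u+v−1) + ∫₁^∞ α^{−v} ζ₁(u,α) dα + ∫₁^∞ α^{−u} ζ₁(v,α) dα. -/
open Complex MeasureTheory Real

theorem norm_zeta1_term (s : ℂ) {x : ℝ} (hx : 0 ≤ x) (n : ℕ) :
    ‖(((n : ℂ) + 1) + (x : ℂ)) ^ (-s)‖ = ((n : ℝ) + 1 + x) ^ (-s.re) := by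
  have h : ((n : ℂ) + 1) + (x : ℂ) = (((n : ℝ) + 1 + x : ℝ) : ℂ) := by push_cast; ring
  rw [h, Complex.norm_cpow_eq_rpow_re_of_pos (by positivity), Complex.neg_re]

theorem norm_zeta1_term_le {s : ℂ} (hs : 1 < s.re) {x : ℝ} (hx : 0 ≤ x) (n : ℕ) :
    ‖(((n : ℂ) + 1) + (x : ℂ)) ^ (-s)‖ ≤ ((n : ℝ) + 1) ^ (-s.re) := by
  rw [norm_zeta1_term s hx]
  exact Real.rpow_le_rpow_of_nonpos (by positivity) (by linarith) (by linarith)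

theorem summable_nat_add_one_rpow_neg {r : ℝ} (hr : 1 < r) :
    Summable fun n : ℕ => ((n : ℝ) + 1) ^ (-r) := by
  have h := (summable_nat_add_iff 1).2 (Real.summable_nat_rpow (p := -r) |>.2 (by linarith))
  simpa using h

theorem summable_zeta1 {s : ℂ} (hs : 1 < s.re) {x : ℝ} (hx : 0 ≤ x) :
    Summable fun n : ℕ => (((n : ℂ) + 1) + (x : ℂ)) ^ (-s) :=
  Summable.of_norm_bounded (summable_nat_add_one_rpow_neg hs) (norm_zeta1_term_le hs hx)

theorem norm_zeta1_le {s : ℂ} (hs : 1 < s.re) {x : ℝ} (hx : 0 ≤ x) :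
    ‖zeta1 s x‖ ≤ ∑' n : ℕ, ((n : ℝ) + 1) ^ (-s.re) :=
  tsum_of_norm_bounded (summable_nat_add_one_rpow_neg hs).hasSum (norm_zeta1_term_le hs hx)

theorem zeta1_eq_add_zeta1_add_one {s : ℂ} (hs : 1 < s.re) {x : ℝ} (hx : 0 ≤ x) :
    zeta1 s x = ((x + 1 : ℝ) : ℂ) ^ (-s) + zeta1 s (x + 1) := by
  rw [zeta1, (summable_zeta1 hs hx).tsum_eq_zero_add, zeta1]
  congr 1
  · push_cast; congr 1; ring
  · refine tsum_congr fun n => ?_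
    push_cast; congr 1; ring

theorem continuousOn_zeta1 {s : ℂ} (hs : 1 < s.re) : ContinuousOn (zeta1 s) (Set.Ici 0) := by
  refine continuousOn_tsum (fun n => ?_) (summable_nat_add_one_rpow_neg hs)
    fun n x hx => norm_zeta1_term_le hs hx n
  refine ContinuousOn.cpow (by fun_prop) continuousOn_const fun x hx => ?_
  left
  have : (0 : ℝ) ≤ x := hx
  simp only [add_re, natCast_re, one_re, ofReal_re]
  positivity

theorem tendsto_zeta1_atTop {s : ℂ} (hs : 1 < s.re) :
    Filter.Tendsto (zeta1 s) Filter.atTop (nhds 0) := by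
  have h := tendsto_tsum_of_dominated_convergence (𝓕 := Filter.atTop)
    (f := fun (x : ℝ) (n : ℕ) => (((n : ℂ) + 1) + (x : ℂ)) ^ (-s)) (g := fun _ => 0)
    (summable_nat_add_one_rpow_neg hs) (fun n => ?_)
    ((Filter.eventually_ge_atTop 0).mono fun x hx n => norm_zeta1_term_le hs hx n)
  · rw [tsum_zero] at h
    exact h
  · rw [tendsto_zero_iff_norm_tendsto_zero]
    have h : Filter.Tendsto (fun x : ℝ => ((n : ℝ) + 1 + x) ^ (-s.re)) Filter.atTop (nhds 0) :=
      (tendsto_rpow_neg_atTop (by linarith)).comp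
        (Filter.tendsto_atTop_add_const_left _ _ Filter.tendsto_id)
    refine h.congr' ?_
    filter_upwards [Filter.eventually_ge_atTop 0] with x hx
    exact (norm_zeta1_term s hx n).symm

theorem integrableOn_cpow_mul_zeta1 {u v : ℂ} (hu : 1 < u.re) (hv : 1 < v.re) :
    IntegrableOn (fun x : ℝ => (x : ℂ) ^ (-v) * zeta1 u x) (Set.Ioi 1) := by
  refine Integrable.mul_bdd (c := ∑' n : ℕ, ((n : ℝ) + 1) ^ (-u.re))
    (integrableOn_Ioi_cpow_of_lt (by simpa using hv) one_pos) ?_ ?_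
  · exact ((continuousOn_zeta1 hu).mono
      (Set.Ioi_subset_Ici zero_le_one)).aestronglyMeasurable measurableSet_Ioi
  · filter_upwards [ae_restrict_mem measurableSet_Ioi] with x hx
    exact norm_zeta1_le hu (zero_lt_one.trans hx).le

theorem tendsto_intervalIntegral_add_one {E : Type*} [NormedAddCommGroup E] [NormedSpace ℝ E]
    {F : ℝ → E} (hF : Filter.Tendsto F Filter.atTop (nhds 0)) :
    Filter.Tendsto (fun N : ℕ => ∫ x in (N : ℝ)..(N + 1), F x) Filter.atTop (nhds 0) := by
  rw [Metric.tendsto_atTop]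
  intro ε hε
  obtain ⟨a, ha⟩ := Filter.eventually_atTop.1
    ((tendsto_zero_iff_norm_tendsto_zero.1 hF).eventually_lt_const (half_pos hε))
  obtain ⟨M, hM⟩ := exists_nat_ge a
  refine ⟨M, fun N hN => ?_⟩
  have hNM : (M : ℝ) ≤ N := by exact_mod_cast hN
  have := intervalIntegral.norm_integral_le_of_norm_le_const (a := (N : ℝ)) (b := N + 1)
    (f := F) (C := ε / 2) fun x hx => by
      rw [Set.uIoc_of_le (by linarith)] at hx
      exact (ha x (by linarith [hx.1])).le
  rw [dist_zero_right]
  simp only [add_sub_cancel_left, abs_one, mul_one] at this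
  linarith

/-- If `F x - F (x + 1) = g (x + 1)` for `x ≥ 0` and `F` vanishes at infinity, then the integral
of `F` over the unit interval unfolds to the integral of `g` over `(1, ∞)`. -/
theorem intervalIntegral_eq_integral_Ioi_of_sub {E : Type*} [NormedAddCommGroup E]
    [NormedSpace ℝ E] {F g : ℝ → E} (hFc : ContinuousOn F (Set.Ici 0))
    (hF : Filter.Tendsto F Filter.atTop (nhds 0)) (hg : IntegrableOn g (Set.Ioi 1))
    (h : ∀ x, 0 ≤ x → F x - F (x + 1) = g (x + 1)) :
    ∫ x in (0 : ℝ)..1, F x = ∫ x in Set.Ioi 1, g x := by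
  have hFi : ∀ a b : ℝ, 0 ≤ a → 0 ≤ b → IntervalIntegrable F volume a b := fun a b ha hb =>
    (hFc.mono fun x hx => (le_min ha hb).trans hx.1).intervalIntegrable
  have hgi : ∀ a b : ℝ, 1 ≤ a → 1 ≤ b → IntervalIntegrable g volume a b := fun a b ha hb =>
    intervalIntegrable_iff.2 (hg.mono_set fun x hx => (le_min ha hb).trans_lt hx.1)
  have key : ∀ N : ℕ, (∫ x in (1 : ℝ)..(N + 1), g x) =
      (∫ x in (0 : ℝ)..1, F x) - ∫ x in (N : ℝ)..(N + 1), F x := by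
    intro N
    induction N with
    | zero => simp
    | succ N ih =>
      have hN : (0 : ℝ) ≤ N := N.cast_nonneg
      have hstep : (∫ x in (N + 1 : ℝ)..(N + 1 + 1), g x) =
          (∫ x in (N : ℝ)..(N + 1), F x) - ∫ x in (N + 1 : ℝ)..(N + 1 + 1), F x := by
        rw [← intervalIntegral.integral_comp_add_right g 1,
          ← intervalIntegral.integral_comp_add_right F 1, ← intervalIntegral.integral_sub
            (hFi _ _ hN (by linarith))]
        · refine intervalIntegral.integral_congr fun x hx => ?_
          rw [Set.uIcc_of_le (by linarith)] at hx
          exact (h x (hN.trans hx.1)).symm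
        · simpa using (hFi (N + 1) (N + 1 + 1) (by linarith) (by linarith)).comp_add_right 1
      push_cast
      rw [← intervalIntegral.integral_add_adjacent_intervals
        (hgi 1 (N + 1) le_rfl (by linarith)) (hgi _ _ (by linarith) (by linarith)), ih, hstep]
      abel
  have h₁ := intervalIntegral_tendsto_integral_Ioi 1 hg
    (Filter.tendsto_atTop_add_const_right _ (1 : ℝ) (tendsto_natCast_atTop_atTop (R := ℝ)))
  have h₂ := (tendsto_intervalIntegral_add_one hF).const_sub (∫ x in (0 : ℝ)..1, F x)
  rw [sub_zero] at h₂
  exact tendsto_nhds_unique (h₂.congr fun N => (key N).symm) h₁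

theorem stmt_8 (u v : ℂ) (hu : 1 < u.re) (hv : 1 < v.re) :
    ∫ α in (0 : ℝ)..1, zeta1 u α * zeta1 v α =
      1 / (u + v - 1) + (∫ α in Set.Ioi (1 : ℝ), (α : ℂ) ^ (-v) * zeta1 u α)
        + ∫ α in Set.Ioi (1 : ℝ), (α : ℂ) ^ (-u) * zeta1 v α := by
  have huv : (-(u + v)).re < -1 := by simp only [neg_re, add_re]; linarith
  have hi : IntegrableOn (fun x : ℝ => (x : ℂ) ^ (-(u + v))) (Set.Ioi 1) :=
    integrableOn_Ioi_cpow_of_lt huv one_pos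
  have hiu := integrableOn_cpow_mul_zeta1 hu hv
  have hiv := integrableOn_cpow_mul_zeta1 hv hu
  have hdiag : ∫ x in Set.Ioi (1 : ℝ), (x : ℂ) ^ (-(u + v)) = 1 / (u + v - 1) := by
    rw [integral_Ioi_cpow_of_lt huv one_pos, ofReal_one, one_cpow, neg_div, ← div_neg]
    congr 1
    ring
  have hsum : IntegrableOn (fun x : ℝ => (x : ℂ) ^ (-(u + v)) + (x : ℂ) ^ (-v) * zeta1 u x)
      (Set.Ioi 1) := hi.add hiu
  rw [← hdiag, ← integral_add hi hiu, ← integral_add hsum hiv]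
  refine intervalIntegral_eq_integral_Ioi_of_sub
    ((continuousOn_zeta1 hu).mul (continuousOn_zeta1 hv))
    (by simpa using (tendsto_zeta1_atTop hu).mul (tendsto_zeta1_atTop hv))
    (hsum.add hiv) fun x hx => ?_
  have hx1 : ((x + 1 : ℝ) : ℂ) ≠ 0 := by
    rw [ofReal_ne_zero]; positivity
  rw [zeta1_eq_add_zeta1_add_one hu hx, zeta1_eq_add_zeta1_add_one hv hx, neg_add,
    cpow_add _ _ hx1]
  ring
end

section
/- Let u, v ∈ ℂ with Re u > 1, Re v < 1, and Re(u+v) > 2. Then ∫₀^∞ α^{−v} ζ₁(u,α) dα = [Γ(1−v) Γ(u+v−1) / Γ(u)] · ζ(u+v−1). -/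
open Complex MeasureTheory Real

theorem ofReal_cpow_eq_exp_log_mul {x : ℝ} (hx : 0 < x) (s : ℂ) :
    (x : ℂ) ^ s = Complex.exp (Real.log x * s) := by
  rw [Complex.cpow_def_of_ne_zero (by exact_mod_cast hx.ne'), Complex.ofReal_log hx.le]

theorem image_mul_div_one_sub_Ioo {c : ℝ} (hc : 0 < c) :
    (fun t : ℝ => c * t / (1 - t)) '' Set.Ioo 0 1 = Set.Ioi 0 := by
  ext y
  simp only [Set.mem_image, Set.mem_Ioo, Set.mem_Ioi]
  constructor
  · rintro ⟨t, ⟨h0, h1⟩, rfl⟩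
    exact div_pos (mul_pos hc h0) (sub_pos.2 h1)
  · intro hy
    have hcy : 0 < c + y := by positivity
    refine ⟨y / (c + y), ⟨by positivity, (div_lt_one hcy).2 (by linarith)⟩, ?_⟩
    have h : 1 - y / (c + y) = c / (c + y) := by field_simp; ring
    rw [h]
    field_simp

theorem injOn_mul_div_one_sub_Ioo {c : ℝ} (hc : 0 < c) :
    Set.InjOn (fun t : ℝ => c * t / (1 - t)) (Set.Ioo 0 1) := by
  intro x hx y hy h
  have hx' : 1 - x ≠ 0 := (sub_pos.2 hx.2).ne'
  have hy' : 1 - y ≠ 0 := (sub_pos.2 hy.2).ne'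
  simp only [div_eq_div_iff hx' hy'] at h
  have : c * (x - y) = 0 := by linarith
  rcases mul_eq_zero.1 this with h | h
  · exact absurd h hc.ne'
  · linarith

theorem hasDerivWithinAt_mul_div_one_sub {c t : ℝ} (ht : t < 1) (s : Set ℝ) :
    HasDerivWithinAt (fun t : ℝ => c * t / (1 - t)) (c / (1 - t) ^ 2) s t := by
  have h := (((hasDerivAt_id t).const_mul c).div ((hasDerivAt_id t).const_sub 1)
    (sub_pos.2 ht).ne').hasDerivWithinAt (s := s)
  refine h.congr_deriv ?_
  simp only [id]
  ring

theorem abs_deriv_smul_cpow_mul_cpow (u v : ℂ) {c t : ℝ} (hc : 0 < c) (ht : t ∈ Set.Ioo (0 : ℝ) 1) :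
    |c / (1 - t) ^ 2| • (((c * t / (1 - t) : ℝ) : ℂ) ^ (-v) *
        ((c + c * t / (1 - t) : ℝ) : ℂ) ^ (-u)) =
      (c : ℂ) ^ (1 - u - v) *
        ((t : ℂ) ^ ((1 - v) - 1) * (1 - (t : ℂ)) ^ ((u + v - 1) - 1)) := by
  have h0 := ht.1
  have h1 : 0 < 1 - t := sub_pos.2 ht.2
  have hsum : c + c * t / (1 - t) = c / (1 - t) := by field_simp; ring
  have hJ : ((c / (1 - t) ^ 2 : ℝ) : ℂ) =
      Complex.exp (Real.log c - 2 * Real.log (1 - t)) := by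
    have : c / (1 - t) ^ 2 = Real.exp (Real.log c - 2 * Real.log (1 - t)) := by
      rw [Real.exp_sub, Real.exp_log hc, two_mul, Real.exp_add, Real.exp_log h1, sq]
    rw [this]
    push_cast
    rfl
  rw [abs_of_pos (by positivity), hsum, Complex.real_smul, hJ,
    show (1 : ℂ) - (t : ℂ) = ((1 - t : ℝ) : ℂ) by push_cast; rfl,
    ofReal_cpow_eq_exp_log_mul (by positivity), ofReal_cpow_eq_exp_log_mul (by positivity),
    ofReal_cpow_eq_exp_log_mul hc, ofReal_cpow_eq_exp_log_mul h0, ofReal_cpow_eq_exp_log_mul h1,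
    Real.log_div (by positivity) h1.ne', Real.log_mul hc.ne' h0.ne', Real.log_div hc.ne' h1.ne']
  simp only [← Complex.exp_add]
  congr 1
  push_cast
  ring

theorem integrableOn_Ioi_cpow_mul_add_cpow {u v : ℂ} (hv : v.re < 1) (huv : 1 < (u + v).re)
    {c : ℝ} (hc : 0 < c) :
    IntegrableOn (fun α : ℝ => (α : ℂ) ^ (-v) * ((c + α : ℝ) : ℂ) ^ (-u)) (Set.Ioi 0) := by
  rw [← image_mul_div_one_sub_Ioo hc, integrableOn_image_iff_integrableOn_abs_deriv_smul
    measurableSet_Ioo (fun t ht => hasDerivWithinAt_mul_div_one_sub ht.2 _)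
    (injOn_mul_div_one_sub_Ioo hc)]
  refine IntegrableOn.congr_fun ?_ (fun t ht => (abs_deriv_smul_cpow_mul_cpow u v hc ht).symm)
    measurableSet_Ioo
  have h := Complex.betaIntegral_convergent (u := 1 - v) (v := u + v - 1)
    (by simpa using hv) (by simpa using huv)
  rw [intervalIntegrable_iff_integrableOn_Ioo_of_le zero_le_one] at h
  exact h.const_mul _

theorem integral_Ioi_cpow_mul_add_cpow (u v : ℂ) {c : ℝ} (hc : 0 < c) :
    ∫ α in Set.Ioi (0 : ℝ), (α : ℂ) ^ (-v) * ((c + α : ℝ) : ℂ) ^ (-u) =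
      (c : ℂ) ^ (1 - u - v) * Complex.betaIntegral (1 - v) (u + v - 1) := by
  rw [← image_mul_div_one_sub_Ioo hc, integral_image_eq_integral_abs_deriv_smul
    measurableSet_Ioo (fun t ht => hasDerivWithinAt_mul_div_one_sub ht.2 _)
    (injOn_mul_div_one_sub_Ioo hc),
    setIntegral_congr_fun measurableSet_Ioo (fun t ht => abs_deriv_smul_cpow_mul_cpow u v hc ht),
    integral_const_mul, Complex.betaIntegral, intervalIntegral.integral_of_le zero_le_one,
    integral_Ioc_eq_integral_Ioo]

theorem integral_Ioi_norm_cpow_mul_add_cpow (u v : ℂ) {c : ℝ} (hc : 0 < c) :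
    ∫ α in Set.Ioi (0 : ℝ), ‖(α : ℂ) ^ (-v) * ((c + α : ℝ) : ℂ) ^ (-u)‖ =
      c ^ (1 - u.re - v.re) * (Complex.betaIntegral (1 - v.re) (u.re + v.re - 1)).re := by
  have h := integral_Ioi_cpow_mul_add_cpow (u.re : ℂ) (v.re : ℂ) hc
  have e : ∫ α in Set.Ioi (0 : ℝ), (α : ℂ) ^ (-(v.re : ℂ)) * ((c + α : ℝ) : ℂ) ^ (-(u.re : ℂ)) =
      ((∫ α in Set.Ioi (0 : ℝ), ‖(α : ℂ) ^ (-v) * ((c + α : ℝ) : ℂ) ^ (-u)‖ : ℝ) : ℂ) := by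
    rw [← integral_complex_ofReal]
    refine setIntegral_congr_fun measurableSet_Ioi fun α (hα : 0 < α) => ?_
    have hcα : 0 < c + α := by positivity
    simp only [norm_mul, Complex.norm_cpow_eq_rpow_re_of_pos hα,
      Complex.norm_cpow_eq_rpow_re_of_pos hcα, Complex.ofReal_mul, Complex.ofReal_cpow hα.le,
      Complex.ofReal_cpow hcα.le, Complex.neg_re, Complex.ofReal_neg]
  rw [e, show (1 : ℂ) - u.re - v.re = ((1 - u.re - v.re : ℝ) : ℂ) by push_cast; rfl,
    ← Complex.ofReal_cpow hc.le] at h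
  simpa only [Complex.ofReal_re, Complex.re_ofReal_mul] using congrArg Complex.re h

theorem stmt_11 (u v : ℂ) (hu : 1 < u.re) (hv : v.re < 1) (huv : 2 < (u + v).re) :
    ∫ α in Set.Ioi (0 : ℝ), (α : ℂ) ^ (-v) * zeta1 u α =
      Complex.Gamma (1 - v) * Complex.Gamma (u + v - 1) / Complex.Gamma u *
        riemannZeta (u + v - 1) := by
  have hpos (n : ℕ) : 0 < (n : ℝ) + 1 := by positivity
  have hre : 2 < u.re + v.re := by simpa using huv
  have hsum : Summable fun n : ℕ => ∫ α in Set.Ioi (0 : ℝ),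
      ‖(α : ℂ) ^ (-v) * (((n : ℝ) + 1 + α : ℝ) : ℂ) ^ (-u)‖ := by
    simp only [integral_Ioi_norm_cpow_mul_add_cpow u v (hpos _)]
    refine Summable.mul_right _ ?_
    have h := (summable_nat_add_iff 1).2
      (Real.summable_nat_rpow (p := 1 - u.re - v.re) |>.2 (by linarith))
    simpa only [Nat.cast_add, Nat.cast_one] using h
  have hint := integral_tsum_of_summable_integral_norm
    (fun n : ℕ => integrableOn_Ioi_cpow_mul_add_cpow hv (one_lt_two.trans huv) (hpos n)) hsum
  have hbeta := Complex.betaIntegral_eq_Gamma_mul_div (1 - v) (u + v - 1)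
    (by simpa using hv) (by simp; linarith)
  rw [show (1 - v) + (u + v - 1) = u by ring] at hbeta
  have hzeta := zeta_eq_tsum_one_div_nat_add_one_cpow (s := u + v - 1) (by simp; linarith)
  simp only [integral_Ioi_cpow_mul_add_cpow u v (hpos _), tsum_mul_right, tsum_mul_left] at hint
  rw [← hbeta, hzeta, mul_comm]
  convert hint.symm using 1
  · simp [zeta1]
  · congr 2
    ext n
    rw [one_div, ← Complex.cpow_neg]
    push_cast
    congr 1
    ring
end

section
/- Fix real numbers σ₁ ∈ (0,2) and σ₂ > 0, and write v = σ₁ − it, u = σ₂ + it. Then, as t → ∞, ∫₀¹ α^{1−v} ζ₁(u+1, α) dα = (1/(it)) ∑_{m=1}^∞ 1/(m (m+1)^u) + O(t^{−2}). -/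
open Complex MeasureTheory Real Filter Asymptotics

/-- The truncated beta-type integral `∫₀¹ α^p (N+α)^{-q} dα`. -/
noncomputable def truncBeta (N : ℝ) (p q : ℂ) : ℂ :=
  ∫ α in (0 : ℝ)..1, (α : ℂ) ^ p * ((N : ℂ) + α) ^ (-q)

lemma continuousOn_shift_cpow {N : ℝ} (hN : 0 < N) (q : ℂ) :
    ContinuousOn (fun α : ℝ => ((N : ℂ) + α) ^ (-q)) (Set.Icc 0 1) := by
  refine ContinuousOn.cpow_const (by fun_prop) fun x hx => ?_
  rw [← Complex.ofReal_add]
  exact Complex.ofReal_mem_slitPlane.2 (by linarith [hx.1])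

lemma intervalIntegrable_truncBeta {N : ℝ} (hN : 0 < N) {p : ℂ} (hp : -1 < p.re) (q : ℂ) :
    IntervalIntegrable (fun α : ℝ => (α : ℂ) ^ p * ((N : ℂ) + α) ^ (-q)) volume 0 1 := by
  refine (intervalIntegral.intervalIntegrable_cpow' hp).mul_continuousOn ?_
  rw [Set.uIcc_of_le zero_le_one]
  exact continuousOn_shift_cpow hN q

lemma integral_norm_truncBeta_le {N : ℝ} (hN : 0 < N) {p q : ℂ} (hp : -1 < p.re)
    (hq : 0 ≤ q.re) :
    ∫ α in (0 : ℝ)..1, ‖(α : ℂ) ^ p * ((N : ℂ) + α) ^ (-q)‖ ≤ N ^ (-q.re) / (p.re + 1) := by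
  have hbound : ∫ α in (0 : ℝ)..1, α ^ p.re * N ^ (-q.re) = N ^ (-q.re) / (p.re + 1) := by
    rw [intervalIntegral.integral_mul_const, integral_rpow (Or.inl hp),
      Real.one_rpow, Real.zero_rpow (by linarith)]
    ring
  rw [← hbound]
  refine intervalIntegral.integral_mono_on_of_le_Ioo zero_le_one
    (intervalIntegrable_truncBeta hN hp q).norm
    ((intervalIntegral.intervalIntegrable_rpow' hp).mul_const _) fun x hx => ?_
  rw [norm_mul, ← Complex.ofReal_add, Complex.norm_cpow_eq_rpow_re_of_pos hx.1,
    Complex.norm_cpow_eq_rpow_re_of_pos (by linarith [hx.1]), Complex.neg_re]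
  exact mul_le_mul_of_nonneg_left
    (Real.rpow_le_rpow_of_nonpos hN (by linarith [hx.1]) (by linarith))
    (Real.rpow_nonneg hx.1.le _)

lemma norm_truncBeta_le {N : ℝ} (hN : 0 < N) {p q : ℂ} (hp : -1 < p.re) (hq : 0 ≤ q.re) :
    ‖truncBeta N p q‖ ≤ N ^ (-q.re) / (p.re + 1) :=
  (intervalIntegral.norm_integral_le_integral_norm zero_le_one).trans
    (integral_norm_truncBeta_le hN hp hq)

/-- The contiguity relation obtained by integrating the derivative of `α^{p+1} (N+α)^{-q}`. -/
lemma truncBeta_recurrence {N : ℝ} (hN : 0 < N) {p : ℂ} (hp : -1 < p.re) (q : ℂ) :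
    (p + 1) * N * truncBeta N p (q + 1) + (p + 1 - q) * truncBeta N (p + 1) (q + 1)
      = ((N : ℂ) + 1) ^ (-q) := by
  have hp1 : -1 < (p + 1).re := by simp; linarith
  have hp0 : p + 1 ≠ 0 := fun h => by
    have := congrArg Complex.re h
    simp at this
    linarith
  have hi := (intervalIntegrable_truncBeta hN hp (q + 1)).const_mul ((p + 1) * N)
  have hi1 := (intervalIntegrable_truncBeta hN hp1 (q + 1)).const_mul (p + 1 - q)
  have hftc := intervalIntegral.integral_eq_sub_of_hasDerivAt_of_le (zero_le_one (α := ℝ))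
    (f := fun α : ℝ => (α : ℂ) ^ (p + 1) * ((N : ℂ) + α) ^ (-q)) ?_ ?_ (hi.add hi1)
  · rw [intervalIntegral.integral_add hi hi1, intervalIntegral.integral_const_mul,
      intervalIntegral.integral_const_mul] at hftc
    simpa [truncBeta, Complex.zero_cpow hp0] using hftc
  · refine ContinuousOn.mul ?_ (continuousOn_shift_cpow hN q)
    exact (Complex.continuous_ofReal_cpow_const (by simp; linarith)).continuousOn
  · intro x hx
    have hx0 : (x : ℂ) ≠ 0 := Complex.ofReal_ne_zero.2 hx.1.ne'
    have hNx : (N : ℂ) + x ≠ 0 := by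
      rw [← Complex.ofReal_add]
      exact Complex.ofReal_ne_zero.2 (by linarith [hx.1])
    have h1 : HasDerivAt (fun α : ℝ => (α : ℂ) ^ (p + 1)) ((p + 1) * (x : ℂ) ^ (p + 1 - 1) * 1) x :=
      ((hasDerivAt_id (x : ℂ)).cpow_const (Complex.ofReal_mem_slitPlane.2 hx.1)).comp_ofReal
    have h2 : HasDerivAt (fun α : ℝ => ((N : ℂ) + α) ^ (-q))
        (-q * ((N : ℂ) + x) ^ (-q - 1) * 1) x := by
      refine (((hasDerivAt_id (x : ℂ)).const_add (N : ℂ)).cpow_const ?_).comp_ofReal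
      simp only [id_eq]
      rw [← Complex.ofReal_add]
      exact Complex.ofReal_mem_slitPlane.2 (by linarith [hx.1])
    have e1 : ((N : ℂ) + x) ^ (-q) = ((N : ℂ) + x) ^ (-(q + 1)) * ((N : ℂ) + x) := by
      rw [show -q = -(q + 1) + 1 by ring, Complex.cpow_add _ _ hNx, Complex.cpow_one]
    refine (h1.mul h2).congr_deriv ?_
    rw [e1, add_sub_cancel_right, show -q - 1 = -(q + 1) by ring, Complex.cpow_add _ _ hx0,
      Complex.cpow_one]
    ring

/-- Leading term of `truncBeta` when both exponents have large imaginary part `t`. -/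
lemma norm_truncBeta_sub_le {N σ₁ σ₂ t : ℝ} (hN : 1 ≤ N) (h₁ : σ₁ < 2) (h₂ : 0 < σ₂)
    (ht : 0 < t) :
    ‖truncBeta N (1 - ((σ₁ : ℂ) - t * Complex.I)) (((σ₂ : ℂ) + t * Complex.I) + 1)
        - 1 / (Complex.I * t) * (1 / ((N : ℂ) * ((N : ℂ) + 1) ^ ((σ₂ : ℂ) + t * Complex.I)))‖
      ≤ (|2 - σ₁| + |2 - σ₁ - σ₂| * (1 + |3 - σ₁ - σ₂|)) * t ^ (-2 : ℝ) * N ^ (-(σ₂ + 1)) := by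
  have hN0 : 0 < N := by linarith
  have hNc : (N : ℂ) ≠ 0 := Complex.ofReal_ne_zero.2 hN0.ne'
  have htc : (t : ℂ) ≠ 0 := Complex.ofReal_ne_zero.2 ht.ne'
  set p : ℂ := 1 - ((σ₁ : ℂ) - t * Complex.I) with hp
  set u : ℂ := (σ₂ : ℂ) + t * Complex.I with hu
  have hpre : p.re = 1 - σ₁ := by simp [hp]
  have hpim : p.im = t := by simp [hp]
  have hure : u.re = σ₂ := by simp [hu]
  have hpt (k : ℝ) : t ≤ ‖p + k‖ := by
    have h := Complex.abs_im_le_norm (p + k)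
    simp only [Complex.add_im, hpim, Complex.ofReal_im, add_zero] at h
    exact (le_abs_self t).trans h
  have hR := truncBeta_recurrence hN0 (p := p) (by rw [hpre]; linarith) u
  have hR1 := truncBeta_recurrence hN0 (p := p + 1) (by simp [hpre]; linarith) u
  have hJ2 := norm_truncBeta_le hN0 (p := p + 1 + 1) (q := u + 1) (by simp [hpre]; linarith)
    (by simp [hure]; linarith)
  set A : ℂ := ((N : ℂ) + 1) ^ (-u) with hA
  have hc : p + 1 - u = ((2 - σ₁ - σ₂ : ℝ) : ℂ) := by
    rw [hp, hu]; push_cast; ring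
  have hc1 : p + 1 + 1 - u = ((3 - σ₁ - σ₂ : ℝ) : ℂ) := by
    rw [hp, hu]; push_cast; ring
  rw [hc] at hR
  rw [hc1] at hR1
  set J := truncBeta N p (u + 1)
  set J1 := truncBeta N (p + 1) (u + 1)
  set J2 := truncBeta N (p + 1 + 1) (u + 1)
  set M : ℝ := N ^ (-σ₂) with hM
  have hM0 : 0 < M := Real.rpow_pos_of_pos hN0 _
  have hAM : ‖A‖ ≤ M := by
    rw [hA, ← Complex.ofReal_one, ← Complex.ofReal_add,
      Complex.norm_cpow_eq_rpow_re_of_pos (by linarith), Complex.neg_re, hure]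
    exact Real.rpow_le_rpow_of_nonpos hN0 (by linarith) (by linarith)
  have hJ2M : ‖J2‖ ≤ M := by
    refine hJ2.trans ((div_le_self (Real.rpow_nonneg hN0.le _) ?_).trans ?_)
    · simp [hpre]; linarith
    · exact Real.rpow_le_rpow_of_exponent_le hN (by simp [hure])
  have hJ1 : t * N * ‖J1‖ ≤ (1 + |3 - σ₁ - σ₂|) * M := by
    have e : (p + 1 + 1) * N * J1 = A - ((3 - σ₁ - σ₂ : ℝ) : ℂ) * J2 := by
      rw [← hR1]; ring
    have h2 : p + 1 + 1 = p + ((2 : ℝ) : ℂ) := by push_cast; ring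
    calc t * N * ‖J1‖ ≤ ‖p + ((2 : ℝ) : ℂ)‖ * N * ‖J1‖ := by gcongr; exact hpt 2
      _ = ‖A - ((3 - σ₁ - σ₂ : ℝ) : ℂ) * J2‖ := by
        rw [← e, h2, norm_mul, norm_mul, Complex.norm_real, Real.norm_of_nonneg hN0.le]
      _ ≤ ‖A‖ + |3 - σ₁ - σ₂| * ‖J2‖ := by
        refine (norm_sub_le _ _).trans_eq ?_
        rw [norm_mul, Complex.norm_real, Real.norm_eq_abs]
      _ ≤ M + |3 - σ₁ - σ₂| * M := by gcongr
      _ = _ := by ring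
  have hJ1' : t * ‖J1‖ ≤ (1 + |3 - σ₁ - σ₂|) * M := by
    refine le_trans ?_ hJ1
    rw [mul_right_comm]
    exact le_mul_of_one_le_right (by positivity) hN
  have hE1 : 1 / ((N : ℂ) * ((N : ℂ) + 1) ^ u) = A / N := by
    rw [hA, Complex.cpow_neg]
    field_simp
  rw [hE1]
  set E := J - 1 / (Complex.I * t) * (A / N) with hE
  have hEt : t * t * N * ‖E‖
      ≤ (|2 - σ₁| + |2 - σ₁ - σ₂| * (1 + |3 - σ₁ - σ₂|)) * M := by
    have e : (p + ((1 : ℝ) : ℂ)) * (Complex.I * t) * N * E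
        = -(((2 - σ₁ : ℝ) : ℂ) * A) - Complex.I * t * (((2 - σ₁ - σ₂ : ℝ) : ℂ) * J1) := by
      have e1 : (p + ((1 : ℝ) : ℂ)) * (Complex.I * t) * N * E
          = (Complex.I * t) * ((p + 1) * N * J) - (p + 1) * A := by
        rw [hE]
        push_cast
        field_simp [Complex.I_ne_zero]
      rw [e1, eq_sub_of_add_eq hR]
      rw [hp]; push_cast; ring
    calc t * t * N * ‖E‖ ≤ ‖p + ((1 : ℝ) : ℂ)‖ * t * N * ‖E‖ := by gcongr; exact hpt 1
      _ = ‖-(((2 - σ₁ : ℝ) : ℂ) * A) - Complex.I * t * (((2 - σ₁ - σ₂ : ℝ) : ℂ) * J1)‖ := by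
        rw [← e]
        simp only [norm_mul, Complex.norm_real, Complex.norm_I, one_mul,
          Real.norm_of_nonneg hN0.le, Real.norm_of_nonneg ht.le]
      _ ≤ |2 - σ₁| * ‖A‖ + |2 - σ₁ - σ₂| * (t * ‖J1‖) := by
        refine (norm_sub_le _ _).trans_eq ?_
        simp only [norm_neg, norm_mul, Complex.norm_real, Complex.norm_I, one_mul,
          Real.norm_of_nonneg ht.le, Real.norm_eq_abs]
        ring
      _ ≤ |2 - σ₁| * M + |2 - σ₁ - σ₂| * ((1 + |3 - σ₁ - σ₂|) * M) := by gcongr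
      _ = _ := by ring
  have hNp : N ^ (-(σ₂ + 1)) = M / N := by
    rw [hM, neg_add, ← sub_eq_add_neg, Real.rpow_sub_one hN0.ne']
  have htp : t ^ (-2 : ℝ) = 1 / (t * t) := by
    rw [Real.rpow_neg ht.le, Real.rpow_two, sq, one_div]
  rw [hNp, htp, mul_one_div, div_mul_div_comm, le_div_iff₀ (by positivity), mul_comm]
  exact hEt

lemma summable_nat_succ_rpow {s : ℝ} (hs : 1 < s) :
    Summable fun n : ℕ => ((n : ℝ) + 1) ^ (-s) := by
  have h := (summable_nat_add_iff 1).2 (Real.summable_nat_rpow.2 (neg_lt_neg hs))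
  simpa using h

lemma hasSum_truncBeta {p q : ℂ} (hp : -1 < p.re) (hq : 1 < q.re) :
    HasSum (fun n : ℕ => truncBeta ((n : ℝ) + 1) p q)
      (∫ α in (0 : ℝ)..1, (α : ℂ) ^ p * zeta1 q α) := by
  have hpos (n : ℕ) : (0 : ℝ) < (n : ℝ) + 1 := by positivity
  have hint (n : ℕ) := intervalIntegrable_truncBeta (hpos n) hp q
  have hs : Summable fun n : ℕ => ∫ α in Set.Ioc (0 : ℝ) 1,
      ‖(α : ℂ) ^ p * ((((n : ℝ) + 1 : ℝ) : ℂ) + α) ^ (-q)‖ := by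
    refine Summable.of_nonneg_of_le (fun n => integral_nonneg fun _ => norm_nonneg _) (fun n => ?_)
      ((summable_nat_succ_rpow hq).div_const (p.re + 1))
    rw [← intervalIntegral.integral_of_le zero_le_one]
    exact integral_norm_truncBeta_le (hpos n) hp (by linarith)
  have h := hasSum_integral_of_summable_integral_norm
    (fun n => (intervalIntegrable_iff_integrableOn_Ioc_of_le zero_le_one).1 (hint n)) hs
  simp only [← intervalIntegral.integral_of_le (zero_le_one (α := ℝ)), tsum_mul_left] at h
  simpa [zeta1, truncBeta] using h

theorem stmt_15 (σ₁ σ₂ : ℝ) (h₁0 : 0 < σ₁) (h₁2 : σ₁ < 2) (h₂ : 0 < σ₂) :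
    (fun t : ℝ =>
        (∫ α in (0 : ℝ)..1,
            (α : ℂ) ^ (1 - ((σ₁ : ℂ) - t * Complex.I)) *
              zeta1 (((σ₂ : ℂ) + t * Complex.I) + 1) α)
          - (1 / (Complex.I * t)) *
              ∑' m : ℕ, 1 / (((m : ℂ) + 1) * ((m : ℂ) + 2) ^ ((σ₂ : ℂ) + t * Complex.I)))
      =O[atTop] fun t : ℝ => t ^ (-2 : ℝ) := by
  set C := |2 - σ₁| + |2 - σ₁ - σ₂| * (1 + |3 - σ₁ - σ₂|)
  have hS := summable_nat_succ_rpow (s := σ₂ + 1) (by linarith)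
  refine IsBigO.of_bound (C * ∑' n : ℕ, ((n : ℝ) + 1) ^ (-(σ₂ + 1))) ?_
  filter_upwards [eventually_gt_atTop 0] with t ht
  have hJ := hasSum_truncBeta (p := 1 - ((σ₁ : ℂ) - t * Complex.I))
    (q := ((σ₂ : ℂ) + t * Complex.I) + 1) (by simp; linarith) (by simpa using h₂)
  have hbound (n : ℕ) := norm_truncBeta_sub_le (N := (n : ℝ) + 1) (by simp) h₁2 h₂ ht
  have hD := Summable.of_norm_bounded (hS.mul_left (C * t ^ (-2 : ℝ))) hbound
  rw [← hJ.tsum_eq, ← tsum_mul_left]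
  have hB := hJ.summable.sub hD
  have hnum (m : ℕ) : ((((m : ℝ) + 1 : ℝ) : ℂ)) + 1 = (m : ℂ) + 2 := by push_cast; ring
  simp only [sub_sub_cancel, hnum] at hB hbound
  push_cast at hB hbound
  have hJs := hJ.summable
  rw [← Summable.tsum_sub hJs hB, Real.norm_of_nonneg (Real.rpow_nonneg ht.le _)]
  refine (tsum_of_norm_bounded (hS.mul_left (C * t ^ (-2 : ℝ))).hasSum hbound).trans_eq ?_
  rw [tsum_mul_left]
  ring
end

section
/- Let s ∈ ℂ with 0 < Re s < 1, and let α ∈ (0,1). Then the symmetric partial sums of the Fourier series converge pointwise: ζ₁(s,α) = 1/(s−1) + lim_{M→∞} ∑_{1≤|n|≤M} a_n(s) e^{2πinα}, where for n ≠ 0 the Fourier coefficient is a_n(s) = Γ(1−s) (2πin)^{s−1} − ∫₀¹ x^{−s} e^{−2πinx} dx, with (2πin)^{s−1} = exp((s−1) Log(2πin)) for the principal branch of the logarithm. -/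
open Complex MeasureTheory Real Filter

/-- The modified Hurwitz zeta function `ζ₁(s, α)` for `0 < α ≤ 1`, defined for all `s ≠ 1`
via the analytically continued Hurwitz zeta function: `ζ₁(s,α) = ζ_H(s,α) - α^{-s}`. -/
noncomputable def zeta1c (s : ℂ) (α : ℝ) : ℂ :=
  HurwitzZeta.hurwitzZeta (α : UnitAddCircle) s - (α : ℂ) ^ (-s)

/-- The `n`-th Fourier coefficient (`n ≠ 0`) of `ζ₁(s,·)` on `(0,1)`:
`a_n(s) = Γ(1-s) (2πin)^{s-1} - ∫₀¹ x^{-s} e^{-2πinx} dx`, with the principal branch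
of the complex power. -/
noncomputable def aCoef (n : ℤ) (s : ℂ) : ℂ :=
  Complex.Gamma (1 - s) * (2 * π * Complex.I * (n : ℂ)) ^ (s - 1)
    - ∫ x in (0 : ℝ)..1, (x : ℂ) ^ (-s) * Complex.exp (-(2 * π * Complex.I * (n : ℂ) * (x : ℂ)))

lemma norm_natCast_cpow_succ_sub_le {w : ℂ} (hw : 0 < w.re) (n : ℕ) :
    ‖((n + 2 : ℕ) : ℂ) ^ (-w) - ((n + 1 : ℕ) : ℂ) ^ (-w)‖ ≤
      ‖w‖ * ((n + 1 : ℕ) : ℝ) ^ (-w.re - 1) := by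
  have hw0 : -w ≠ 0 := fun h => by simp [neg_eq_zero.mp h] at hw
  have hn : (0 : ℝ) < ((n + 1 : ℕ) : ℝ) := by positivity
  have key := norm_image_sub_le_of_norm_deriv_le_segment'
    (f := fun x : ℝ => (x : ℂ) ^ (-w)) (f' := fun x : ℝ => -w * (x : ℂ) ^ (-w - 1))
    (a := ((n + 1 : ℕ) : ℝ)) (b := ((n + 2 : ℕ) : ℝ))
    (C := ‖w‖ * ((n + 1 : ℕ) : ℝ) ^ (-w.re - 1))
    (fun x hx => (hasDerivAt_ofReal_cpow_const (hn.trans_le hx.1).ne' hw0).hasDerivWithinAt)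
    (fun x hx => by
      rw [norm_mul, norm_neg, norm_cpow_eq_rpow_re_of_pos (hn.trans_le hx.1)]
      gcongr
      simp only [sub_re, neg_re, one_re]
      exact Real.rpow_le_rpow_of_nonpos hn hx.1 (by linarith))
    ((n + 2 : ℕ) : ℝ) ⟨by push_cast; linarith, le_rfl⟩
  have h1 : ((n + 2 : ℕ) : ℝ) - ((n + 1 : ℕ) : ℝ) = 1 := by push_cast; ring
  rw [h1, mul_one] at key
  simpa only [ofReal_natCast] using key

lemma one_sub_mul_sum_pow_mul (z : ℂ) (a : ℕ → ℂ) (M : ℕ) :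
    (1 - z) * ∑ n ∈ Finset.range M, z ^ (n + 1) * a n =
      z * a 0 + ∑ n ∈ Finset.range M, z ^ (n + 2) * (a (n + 1) - a n) - z ^ (M + 1) * a M := by
  induction M with
  | zero => simp
  | succ M ih =>
    rw [Finset.sum_range_succ, Finset.sum_range_succ, mul_add, ih]
    ring

/-- The Dirichlet series of the exponential zeta function converges conditionally for `0 < re w`. -/
lemma tendsto_sum_range_expZeta {α : ℝ} (hα : (α : UnitAddCircle) ≠ 0) {w : ℂ} (hw : 0 < w.re) :
    Tendsto (fun M : ℕ => ∑ n ∈ Finset.range M,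
      Complex.exp (2 * π * Complex.I * α) ^ (n + 1) * ((n + 1 : ℕ) : ℂ) ^ (-w))
      atTop (nhds (HurwitzZeta.expZeta α w)) := by
  set z := Complex.exp (2 * π * Complex.I * α) with hz
  have hz1 : 1 - z ≠ 0 := by
    intro h
    obtain ⟨n, hn⟩ := Complex.exp_eq_one_iff.mp (sub_eq_zero.mp h).symm
    apply hα
    have h2 : (α : ℂ) = n := by
      have := Complex.two_pi_I_ne_zero
      apply mul_left_cancel₀ this
      rw [hn]; ring
    have h3 : α = n := by exact_mod_cast h2
    rw [AddCircle.coe_eq_zero_iff]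
    exact ⟨n, by simp [h3]⟩
  have hzn : ‖z‖ = 1 := by
    rw [hz, show 2 * π * Complex.I * α = ((2 * π * α : ℝ) : ℂ) * Complex.I by push_cast; ring]
    exact Complex.norm_exp_ofReal_mul_I _
  set F : ℕ → ℂ → ℂ := fun n v =>
    z ^ (n + 2) * (((n + 2 : ℕ) : ℂ) ^ (-v) - ((n + 1 : ℕ) : ℂ) ^ (-v)) with hF
  have hFn (n : ℕ) {v : ℂ} (hv : 0 < v.re) :
      ‖F n v‖ ≤ ‖v‖ * ((n + 1 : ℕ) : ℝ) ^ (-v.re - 1) := by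
    rw [hF, norm_mul, norm_pow, hzn, one_pow, one_mul]
    exact norm_natCast_cpow_succ_sub_le hv n
  have hsum {ε : ℝ} (hε : 0 < ε) (R : ℝ) :
      Summable fun n : ℕ => R * ((n + 1 : ℕ) : ℝ) ^ (-ε - 1) :=
    (((summable_nat_add_iff 1).mpr (Real.summable_nat_rpow.mpr (by linarith : -ε - 1 < -1)))).mul_left R
  have hlim {v : ℂ} (hv : 0 < v.re) : Tendsto (fun M : ℕ => ∑ n ∈ Finset.range M,
      z ^ (n + 1) * ((n + 1 : ℕ) : ℂ) ^ (-v)) atTop (nhds ((1 - z)⁻¹ * (z + ∑' n, F n v))) := by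
    have h0 : Tendsto (fun M : ℕ => z ^ (M + 1) * ((M + 1 : ℕ) : ℂ) ^ (-v)) atTop (nhds 0) := by
      rw [tendsto_zero_iff_norm_tendsto_zero]
      have h1 : Tendsto (fun M : ℕ => ((M + 1 : ℕ) : ℝ) ^ (-v.re)) atTop (nhds 0) :=
        (tendsto_rpow_neg_atTop hv).comp
          (tendsto_natCast_atTop_atTop.comp (tendsto_add_atTop_nat 1))
      refine h1.congr fun M => ?_
      rw [norm_mul, norm_pow, hzn, one_pow, one_mul, norm_natCast_cpow_of_pos (by omega), neg_re]
    have hs := (Summable.of_norm_bounded (hsum hv ‖v‖) (fun n => hFn n hv)).hasSum.tendsto_sum_nat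
    have h2 := (((hs.const_add z).sub h0).const_mul (1 - z)⁻¹)
    rw [sub_zero] at h2
    refine h2.congr fun M => ?_
    rw [inv_mul_eq_iff_eq_mul₀ hz1]
    have := one_sub_mul_sum_pow_mul z (fun n => ((n + 1 : ℕ) : ℂ) ^ (-v)) M
    rw [this]
    simp [hF, add_assoc, one_add_one_eq_two]
  suffices h : HurwitzZeta.expZeta α w = (1 - z)⁻¹ * (z + ∑' n, F n w) by
    rw [h]; exact hlim hw
  set U : Set ℂ := {v | w.re / 2 < v.re} ∩ Metric.ball 0 (‖w‖ + 3) with hU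
  have hUo : IsOpen U := (isOpen_lt continuous_const continuous_re).inter Metric.isOpen_ball
  have hUc : Convex ℝ U := (convex_halfSpace_re_gt _).inter (convex_ball _ _)
  have hwU : w ∈ U := ⟨half_lt_self hw, by simp⟩
  have h2U : w + 2 ∈ U := by
    refine ⟨by simp; linarith, ?_⟩
    rw [mem_ball_zero_iff]
    refine (norm_add_le _ _).trans_lt ?_
    simp
    norm_num
  have hd : DifferentiableOn ℂ (fun v => (1 - z)⁻¹ * (z + ∑' n, F n v)) U := by
    refine DifferentiableOn.const_mul (DifferentiableOn.const_add _ ?_) _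
    refine differentiableOn_tsum_of_summable_norm (hsum (half_pos hw) (‖w‖ + 3)) ?_ hUo ?_
    · intro n
      have hc (m : ℕ) (hm : m ≠ 0) : Differentiable ℂ fun v : ℂ => (m : ℂ) ^ (-v) := fun v =>
        (differentiableAt_id.neg).const_cpow (Or.inl (by exact_mod_cast hm))
      exact (((hc (n + 2) (by omega)).sub (hc (n + 1) (by omega))).const_mul _).differentiableOn
    · intro n v hv
      have hv1 : w.re / 2 < v.re := hv.1
      have hv2 : ‖v‖ < ‖w‖ + 3 := mem_ball_zero_iff.mp hv.2
      refine (hFn n (by linarith)).trans ?_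
      gcongr
      simp
  have he : AnalyticOnNhd ℂ (HurwitzZeta.expZeta α) U :=
    (HurwitzZeta.differentiable_expZeta_of_ne_zero hα).differentiableOn.analyticOnNhd hUo
  refine he.eqOn_of_preconnected_of_eventuallyEq (hd.analyticOnNhd hUo)
    hUc.isPreconnected h2U ?_ hwU
  have hev : ∀ᶠ v : ℂ in nhds (w + 2), 1 < v.re :=
    (isOpen_lt continuous_const continuous_re).mem_nhds (by simp; linarith)
  filter_upwards [hev] with v hv
  refine tendsto_nhds_unique ?_ (hlim (by linarith))
  have hs := HurwitzZeta.hasSum_expZeta_of_one_lt_re α hv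
  have hv0 : v ≠ 0 := fun h => by simp [h] at hv; linarith
  refine ((tendsto_add_atTop_iff_nat 1).mpr hs.tendsto_sum_nat).congr fun M => ?_
  rw [Finset.sum_range_succ']
  simp only [CharP.cast_eq_zero, zero_cpow hv0, div_zero, add_zero]
  refine Finset.sum_congr rfl fun n _ => ?_
  rw [cpow_neg, ← div_eq_mul_inv, hz, ← Complex.exp_nat_mul]
  congr 2
  push_cast
  ring

lemma sub_one_mul_dirichletKernel {u : ℂ} (hu : u ≠ 0) (M : ℕ) :
    (u - 1) * (1 + ∑ n ∈ Finset.Icc 1 M, (u ^ n + u⁻¹ ^ n)) = u ^ (M + 1) - u⁻¹ ^ M := by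
  induction M with
  | zero => simp
  | succ M ih =>
    rw [Finset.sum_Icc_succ_top (by omega), ← add_assoc, mul_add, ih]
    have : u * u⁻¹ ^ (M + 1) = u⁻¹ ^ M := by
      rw [pow_succ', ← mul_assoc, mul_inv_cancel₀ hu, one_mul]
    linear_combination this

lemma tendsto_intervalIntegral_mul_exp_cocompact (g : ℝ → ℂ) :
    Tendsto (fun w : ℝ => ∫ x in (0 : ℝ)..1, g x * Complex.exp (-(2 * π * Complex.I * w * x)))
      (cocompact ℝ) (nhds 0) := by
  refine (Real.tendsto_integral_exp_smul_cocompact ((Set.Ioc (0 : ℝ) 1).indicator g)).congr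
    fun w => ?_
  rw [intervalIntegral.integral_of_le zero_le_one, ← integral_indicator measurableSet_Ioc]
  refine integral_congr_ae (ae_of_all _ fun x => ?_)
  by_cases hx : x ∈ Set.Ioc (0 : ℝ) 1
  · simp only [Set.indicator_of_mem hx, Circle.smul_def, Real.fourierChar_apply, smul_eq_mul]
    rw [mul_comm]
    congr 2
    push_cast
    ring
  · simp [Set.indicator_of_notMem hx]

lemma integral_exp_two_pi_mul_sub {k : ℤ} (hk : k ≠ 0) (α : ℝ) :
    ∫ x in (0 : ℝ)..1, Complex.exp (2 * π * Complex.I * k * (α - x)) = 0 := by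
  have hc : -(2 * π * Complex.I * k) ≠ 0 :=
    neg_ne_zero.mpr (mul_ne_zero Complex.two_pi_I_ne_zero (by exact_mod_cast hk))
  have h (x : ℝ) : Complex.exp (2 * π * Complex.I * k * (α - x)) =
      Complex.exp (2 * π * Complex.I * k * α) * Complex.exp (-(2 * π * Complex.I * k) * x) := by
    rw [← Complex.exp_add]; congr 1; ring
  simp_rw [h]
  rw [intervalIntegral.integral_const_mul, integral_exp_mul_complex hc]
  have h1 : Complex.exp (-(2 * π * Complex.I * k)) = 1 :=
    Complex.exp_eq_one_iff.mpr ⟨-k, by push_cast; ring⟩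
  simp [h1]

lemma exp_two_pi_mul_sub_ne_one {α x : ℝ} (hα0 : 0 < α) (hα1 : α < 1) (hx : x ∈ Set.Icc 0 1)
    (hne : x ≠ α) : Complex.exp (2 * π * Complex.I * (α - x)) ≠ 1 := by
  intro h
  obtain ⟨n, hn⟩ := Complex.exp_eq_one_iff.mp h
  have h2 : ((α - x : ℝ) : ℂ) = n := by
    apply mul_left_cancel₀ Complex.two_pi_I_ne_zero
    push_cast
    rw [hn]; ring
  have h3 : α - x = n := by exact_mod_cast h2
  have h4 : (n : ℝ) < ((1 : ℤ) : ℝ) := by push_cast; linarith [hx.1]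
  have h5 : ((-1 : ℤ) : ℝ) < n := by push_cast; linarith [hx.2]
  rw [Int.cast_lt] at h4 h5
  rw [show n = 0 by omega, Int.cast_zero] at h3
  exact hne (by linarith)

/-- The difference quotient appearing in Dini's criterion is integrable. -/
lemma intervalIntegrable_div_exp_sub_one {f : ℝ → ℂ} {α : ℝ} (hα0 : 0 < α) (hα1 : α < 1)
    (hf : IntervalIntegrable f volume 0 1) (hc : ContinuousOn f (Set.Icc (α / 2) 1))
    (hd : DifferentiableAt ℝ f α) :
    IntervalIntegrable
      (fun x : ℝ => (f x - f α) / (Complex.exp (2 * π * Complex.I * (α - x)) - 1)) volume 0 1 := by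
  set E : ℝ → ℂ := fun x => Complex.exp (2 * π * Complex.I * (α - x)) with hE
  have hEα : E α = 1 := by simp [hE]
  have hEd (x : ℝ) : HasDerivAt E (E x * -(2 * π * Complex.I)) x := by
    have h1 : HasDerivAt (fun x : ℝ => 2 * π * Complex.I * ((α : ℂ) - x))
        (2 * π * Complex.I * (-1)) x :=
      (((hasDerivAt_id x).ofReal_comp).const_sub (α : ℂ)).const_mul _
    convert h1.cexp using 1
    ring
  have hEs : ContinuousOn (dslope E α) Set.univ :=
    (continuousOn_dslope univ_mem).mpr
      ⟨fun x _ => (hEd x).continuousAt.continuousWithinAt, (hEd α).differentiableAt⟩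
  have hE0 : ∀ x ∈ Set.uIcc (0 : ℝ) 1, dslope E α x ≠ 0 := by
    intro x hx
    rw [Set.uIcc_of_le zero_le_one] at hx
    rcases eq_or_ne x α with rfl | hne
    · rw [dslope_same, (hEd x).deriv, hEα, one_mul]
      exact neg_ne_zero.mpr Complex.two_pi_I_ne_zero
    · rw [dslope_of_ne _ hne, slope_def_module, hEα]
      refine smul_ne_zero (inv_ne_zero (sub_ne_zero.mpr hne)) (sub_ne_zero.mpr
        (exp_two_pi_mul_sub_ne_one hα0 hα1 hx hne))
  have hfs : IntervalIntegrable (dslope f α) volume 0 1 := by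
    have hr : IntervalIntegrable (dslope f α) volume (α / 2) 1 := by
      apply ContinuousOn.intervalIntegrable
      rw [Set.uIcc_of_le (by linarith)]
      exact (continuousOn_dslope (Icc_mem_nhds (by linarith) hα1)).mpr ⟨hc, hd⟩
    have hl : IntervalIntegrable (dslope f α) volume 0 (α / 2) := by
      have h1 : IntervalIntegrable (fun x => f x - f α) volume 0 (α / 2) :=
        (hf.mono_set (by
          rw [Set.uIcc_of_le (by linarith), Set.uIcc_of_le zero_le_one]
          exact Set.Icc_subset_Icc le_rfl (by linarith))).sub intervalIntegrable_const
      have h2 : ContinuousOn (fun x : ℝ => (x - α)⁻¹) (Set.uIcc 0 (α / 2)) := by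
        rw [Set.uIcc_of_le (by linarith)]
        exact (continuousOn_id.sub continuousOn_const).inv₀ fun x hx =>
          (sub_neg.mpr (hx.2.trans_lt (half_lt_self hα0))).ne
      refine (h1.continuousOn_smul h2).congr (fun x hx => ?_)
      rw [Set.uIoc_of_le (by linarith)] at hx
      have hxα : x < α := by linarith [hx.2]
      rw [dslope_of_ne _ hxα.ne, slope_def_module]
    exact hl.trans hr
  have hq := hfs.mul_continuousOn ((hEs.mono (Set.subset_univ _)).inv₀ hE0)
  refine hq.congr_ae ?_
  have hae : ∀ᵐ x : ℝ, x ≠ α := by simp [ae_iff, measure_singleton]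
  filter_upwards [ae_restrict_of_ae hae] with x hx
  have : ((x - α : ℝ) : ℂ) ≠ 0 := by exact_mod_cast sub_ne_zero.mpr hx
  rw [Pi.inv_apply, dslope_of_ne _ hx, dslope_of_ne _ hx, slope_def_module, slope_def_module, hEα]
  simp only [Complex.real_smul, ofReal_inv, mul_inv, inv_inv]
  field_simp
  rfl

/-- Pointwise convergence of the Fourier series at a point of differentiability. -/
lemma tendsto_fourier_partial_sum {f : ℝ → ℂ} {α : ℝ} (hα0 : 0 < α) (hα1 : α < 1)
    (hf : IntervalIntegrable f volume 0 1) (hc : ContinuousOn f (Set.Icc (α / 2) 1))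
    (hd : DifferentiableAt ℝ f α) :
    Tendsto
      (fun M : ℕ => ∑ n ∈ Finset.Icc 1 M,
        ((∫ x in (0 : ℝ)..1, f x * Complex.exp (-(2 * π * Complex.I * ((n : ℤ) : ℂ) * (x : ℂ)))) *
            Complex.exp (2 * π * Complex.I * (n : ℂ) * (α : ℂ)) +
          (∫ x in (0 : ℝ)..1,
              f x * Complex.exp (-(2 * π * Complex.I * ((-(n : ℤ) : ℤ) : ℂ) * (x : ℂ)))) *
            Complex.exp (-(2 * π * Complex.I * (n : ℂ) * (α : ℂ)))))
      atTop (nhds (f α - ∫ x in (0 : ℝ)..1, f x)) := by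
  set u : ℝ → ℂ := fun x => Complex.exp (2 * π * Complex.I * (α - x)) with hu
  have hu0 (x : ℝ) : u x ≠ 0 := Complex.exp_ne_zero _
  have huc : Continuous u := by fun_prop
  have hupow (n : ℕ) (x : ℝ) : u x ^ n = Complex.exp (2 * π * Complex.I * (n : ℤ) * (α - x)) := by
    rw [hu, ← Complex.exp_nat_mul]; congr 1; push_cast; ring
  have huinv (n : ℕ) (x : ℝ) :
      (u x)⁻¹ ^ n = Complex.exp (2 * π * Complex.I * (-(n : ℤ) : ℤ) * (α - x)) := by
    rw [hu, ← Complex.exp_neg, ← Complex.exp_nat_mul]; congr 1; push_cast; ring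
  have huic : Continuous fun x => (u x)⁻¹ := huc.inv₀ hu0
  set g : ℝ → ℂ := fun x => (f x - f α) / (u x - 1) with hg
  have hgi : IntervalIntegrable g volume 0 1 := intervalIntegrable_div_exp_sub_one hα0 hα1 hf hc hd
  have hRL (κ : ℕ → ℤ) (hκ : Tendsto (fun M => (κ M : ℝ)) atTop (cocompact ℝ)) :
      Tendsto (fun M : ℕ => ∫ x in (0 : ℝ)..1, g x * Complex.exp (2 * π * Complex.I * κ M * (α - x)))
        atTop (nhds 0) := by
    have h1 := (tendsto_intervalIntegral_mul_exp_cocompact g).comp hκ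
    rw [tendsto_zero_iff_norm_tendsto_zero] at h1 ⊢
    refine h1.congr fun M => ?_
    have h2 (x : ℝ) : g x * Complex.exp (2 * π * Complex.I * κ M * (α - x)) =
        g x * Complex.exp (-(2 * π * Complex.I * (κ M : ℝ) * x)) *
          Complex.exp (((2 * π * κ M * α : ℝ) : ℂ) * Complex.I) := by
      rw [mul_assoc (g x), ← Complex.exp_add]; congr 2; push_cast; ring
    simp_rw [h2]
    rw [intervalIntegral.integral_mul_const, norm_mul, Complex.norm_exp_ofReal_mul_I, mul_one]
    rfl
  have hA : Tendsto (fun M : ℕ => ∫ x in (0 : ℝ)..1, g x * u x ^ (M + 1)) atTop (nhds 0) := by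
    simp_rw [hupow]
    refine hRL (fun M => ((M + 1 : ℕ) : ℤ)) (Tendsto.mono_right ?_ atTop_le_cocompact)
    exact_mod_cast (tendsto_natCast_atTop_atTop (R := ℝ)).comp (tendsto_add_atTop_nat 1)
  have hB : Tendsto (fun M : ℕ => ∫ x in (0 : ℝ)..1, g x * (u x)⁻¹ ^ M) atTop (nhds 0) := by
    simp_rw [huinv]
    refine hRL (fun M => -(M : ℤ)) (Tendsto.mono_right ?_ atBot_le_cocompact)
    push_cast
    exact tendsto_neg_atTop_atBot.comp (tendsto_natCast_atTop_atTop (R := ℝ))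
  have hAB := (hA.sub hB).add_const (f α - ∫ x in (0 : ℝ)..1, f x)
  rw [sub_zero, zero_add] at hAB
  refine hAB.congr fun M => ?_
  have hfi : IntervalIntegrable (fun x => f x - f α) volume 0 1 :=
    hf.sub intervalIntegrable_const
  have hfu (n : ℕ) : IntervalIntegrable (fun x => (f x - f α) * u x ^ n) volume 0 1 :=
    hfi.mul_continuousOn (huc.pow n).continuousOn
  have hfui (n : ℕ) : IntervalIntegrable (fun x => (f x - f α) * (u x)⁻¹ ^ n) volume 0 1 :=
    hfi.mul_continuousOn (huic.pow n).continuousOn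
  have hker : (∫ x in (0 : ℝ)..1, g x * u x ^ (M + 1)) - ∫ x in (0 : ℝ)..1, g x * (u x)⁻¹ ^ M =
      (∫ x in (0 : ℝ)..1, (f x - f α)) + ∑ n ∈ Finset.Icc 1 M,
        ((∫ x in (0 : ℝ)..1, (f x - f α) * u x ^ n) +
          ∫ x in (0 : ℝ)..1, (f x - f α) * (u x)⁻¹ ^ n) := by
    have hgu : IntervalIntegrable (fun x => g x * u x ^ (M + 1)) volume 0 1 :=
      hgi.mul_continuousOn (huc.pow _).continuousOn
    have hgui : IntervalIntegrable (fun x => g x * (u x)⁻¹ ^ M) volume 0 1 :=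
      hgi.mul_continuousOn (huic.pow _).continuousOn
    have hsum : IntervalIntegrable (fun x => ∑ n ∈ Finset.Icc 1 M,
        ((f x - f α) * u x ^ n + (f x - f α) * (u x)⁻¹ ^ n)) volume 0 1 := by
      simpa only [Finset.sum_fn] using
        IntervalIntegrable.sum (Finset.Icc 1 M) fun n _ => (hfu n).add (hfui n)
    rw [← intervalIntegral.integral_sub hgu hgui]
    simp_rw [← intervalIntegral.integral_add (hfu _) (hfui _)]
    rw [← intervalIntegral.integral_finsetSum fun n _ => (hfu n).add (hfui n),
      ← intervalIntegral.integral_add hfi hsum]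
    refine intervalIntegral.integral_congr_ae ?_
    have hae : ∀ᵐ x : ℝ, x ≠ α := by simp [ae_iff, measure_singleton]
    filter_upwards [hae] with x hx hx01
    rw [Set.uIoc_of_le zero_le_one] at hx01
    have hx1 : u x - 1 ≠ 0 := sub_ne_zero.mpr (exp_two_pi_mul_sub_ne_one hα0 hα1 ⟨hx01.1.le, hx01.2⟩ hx)
    rw [← mul_sub, ← sub_one_mul_dirichletKernel (hu0 x), hg, ← mul_assoc, div_mul_cancel₀ _ hx1,
      mul_add, mul_one, Finset.mul_sum]
    simp_rw [mul_add]
  rw [hker, intervalIntegral.integral_sub hf intervalIntegrable_const]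
  have hterm (k : ℤ) (hk : k ≠ 0) :
      ∫ x in (0 : ℝ)..1, (f x - f α) * Complex.exp (2 * π * Complex.I * k * (α - x)) =
        (∫ x in (0 : ℝ)..1, f x * Complex.exp (-(2 * π * Complex.I * (k : ℂ) * (x : ℂ)))) *
            Complex.exp (2 * π * Complex.I * k * α) := by
    have hcont : Continuous fun x : ℝ => Complex.exp (2 * π * Complex.I * k * (α - x)) := by
      fun_prop
    simp_rw [sub_mul]
    rw [intervalIntegral.integral_sub (hf.mul_continuousOn hcont.continuousOn)
      ((hcont.intervalIntegrable _ _).const_mul _), intervalIntegral.integral_const_mul,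
      integral_exp_two_pi_mul_sub hk, mul_zero, sub_zero, ← intervalIntegral.integral_mul_const]
    refine intervalIntegral.integral_congr fun x _ => ?_
    simp only [mul_assoc, ← Complex.exp_add]
    congr 2
    ring
  have hconst : ∫ _ in (0 : ℝ)..1, f α = f α := by simp
  rw [hconst, add_comm _ (∑ n ∈ Finset.Icc 1 M, _), add_assoc,
    sub_add_sub_cancel', sub_self, add_zero]
  refine Finset.sum_congr rfl fun n hn => ?_
  have hn0 : (n : ℤ) ≠ 0 := by have := (Finset.mem_Icc.mp hn).1; omega
  simp_rw [hupow, huinv]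
  rw [hterm _ hn0, hterm _ (neg_ne_zero.mpr hn0)]
  congr 3
  push_cast
  ring

lemma two_pi_I_mul_natCast_cpow_neg {n : ℕ} (hn : 0 < n) (w : ℂ) :
    (2 * π * Complex.I * n) ^ (-w) =
      (2 * π) ^ (-w) * Complex.exp (-π * Complex.I * w / 2) * (n : ℂ) ^ (-w) := by
  have hn' : (0 : ℝ) < n := by exact_mod_cast hn
  have hr : (0 : ℝ) < 2 * π * n := by positivity
  have h1 : ((2 * π * n : ℝ) : ℂ) ^ (-w) = (2 * π) ^ (-w) * (n : ℂ) ^ (-w) := by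
    rw [ofReal_mul, Complex.mul_cpow_ofReal_nonneg (by positivity) hn'.le]
    push_cast
    rfl
  rw [mul_right_comm ((2 : ℂ) * π), mul_right_comm _ _ ((n : ℂ) ^ (-w)), ← h1,
    show (2 * π * n : ℂ) * Complex.I = ((2 * π * n : ℝ) : ℂ) * Complex.I by push_cast; ring,
    cpow_def_of_ne_zero (mul_ne_zero (by exact_mod_cast hr.ne') Complex.I_ne_zero),
    cpow_def_of_ne_zero (by exact_mod_cast hr.ne'), Complex.log_ofReal_mul hr Complex.I_ne_zero,
    Complex.log_I, ← Complex.exp_add, Complex.ofReal_log hr.le]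
  congr 1
  ring

lemma two_pi_I_mul_neg_natCast_cpow_neg {n : ℕ} (hn : 0 < n) (w : ℂ) :
    (2 * π * Complex.I * (-n)) ^ (-w) =
      (2 * π) ^ (-w) * Complex.exp (π * Complex.I * w / 2) * (n : ℂ) ^ (-w) := by
  have hn' : (0 : ℝ) < n := by exact_mod_cast hn
  have hr : (0 : ℝ) < 2 * π * n := by positivity
  have hI : -Complex.I ≠ 0 := neg_ne_zero.mpr Complex.I_ne_zero
  have h1 : ((2 * π * n : ℝ) : ℂ) ^ (-w) = (2 * π) ^ (-w) * (n : ℂ) ^ (-w) := by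
    rw [ofReal_mul, Complex.mul_cpow_ofReal_nonneg (by positivity) hn'.le]
    push_cast
    rfl
  rw [mul_right_comm _ _ ((n : ℂ) ^ (-w)), ← h1,
    show (2 * π * Complex.I * (-n) : ℂ) = ((2 * π * n : ℝ) : ℂ) * (-Complex.I) by push_cast; ring,
    cpow_def_of_ne_zero (mul_ne_zero (by exact_mod_cast hr.ne') hI),
    cpow_def_of_ne_zero (by exact_mod_cast hr.ne'), Complex.log_ofReal_mul hr hI,
    Complex.log_neg_I, ← Complex.exp_add, Complex.ofReal_log hr.le]
  congr 1
  ring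

theorem stmt_16 (s : ℂ) (hs0 : 0 < s.re) (hs1 : s.re < 1) (α : ℝ) (hα0 : 0 < α) (hα1 : α < 1) :
    Tendsto
      (fun M : ℕ => ∑ n ∈ Finset.Icc 1 M,
        (aCoef (n : ℤ) s * Complex.exp (2 * π * Complex.I * (n : ℂ) * (α : ℂ)) +
          aCoef (-(n : ℤ)) s * Complex.exp (-(2 * π * Complex.I * (n : ℂ) * (α : ℂ)))))
      atTop (nhds (zeta1c s α - 1 / (s - 1))) := by
  have hα : (α : UnitAddCircle) ≠ 0 := by
    rw [Ne, AddCircle.coe_eq_zero_iff]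
    rintro ⟨n, hn⟩
    rw [zsmul_eq_mul, mul_one] at hn
    have h1 : 0 < n := by exact_mod_cast hn ▸ hα0
    have h2 : n < 1 := by exact_mod_cast hn ▸ hα1
    omega
  have hw : 0 < (1 - s).re := by simpa using hs1
  have hF := tendsto_fourier_partial_sum (f := fun x : ℝ => (x : ℂ) ^ (-s)) hα0 hα1
    (intervalIntegral.intervalIntegrable_cpow' (by simpa using hs1))
    (fun x hx => (continuousAt_ofReal_cpow_const x _
      (Or.inr (by linarith [hx.1] : 0 < x).ne')).continuousWithinAt)
    (hasDerivAt_ofReal_cpow_const hα0.ne' (fun h => by simp [neg_eq_zero.mp h] at hs0)).differentiableAt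
  have hint : ∫ x in (0 : ℝ)..1, (x : ℂ) ^ (-s) = 1 / (1 - s) := by
    have h0 : -s + 1 ≠ 0 := fun h => by
      rw [neg_add_eq_sub] at h
      simp [h] at hw
    rw [integral_cpow (Or.inl (by simpa using hs1)), ofReal_one, one_cpow, ofReal_zero,
      zero_cpow h0, sub_zero, neg_add_eq_sub]
  have hE1 := (tendsto_sum_range_expZeta hα hw).const_mul
    (Complex.exp (-π * Complex.I * (1 - s) / 2))
  have hα' : ((-α : ℝ) : UnitAddCircle) ≠ 0 := by simpa using hα
  have hE2 := (tendsto_sum_range_expZeta hα' hw).const_mul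
    (Complex.exp (π * Complex.I * (1 - s) / 2))
  have hG := (hE1.add hE2).const_mul ((2 * π) ^ (-(1 - s)) * Complex.Gamma (1 - s))
  rw [AddCircle.coe_neg, ← HurwitzZeta.hurwitzZeta_one_sub _ (fun n h => ?_) (Or.inl hα),
    sub_sub_cancel] at hG
  swap
  · rw [h] at hw
    simp at hw
    linarith [(Nat.cast_nonneg n : (0 : ℝ) ≤ n)]
  have hlim := hG.sub hF
  have hval : zeta1c s α - 1 / (s - 1) = HurwitzZeta.hurwitzZeta α s -
      ((α : ℂ) ^ (-s) - ∫ x in (0 : ℝ)..1, (x : ℂ) ^ (-s)) := by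
    rw [hint, zeta1c, ← neg_sub s 1, div_neg]
    ring
  rw [hval]
  refine hlim.congr fun M => ?_
  have hIcc (h : ℕ → ℂ) : ∑ n ∈ Finset.Icc 1 M, h n = ∑ n ∈ Finset.range M, h (n + 1) := by
    rw [Finset.range_eq_Ico, Finset.sum_Ico_add' h 0 M 1]
    rfl
  rw [hIcc, hIcc, Finset.mul_sum, Finset.mul_sum, ← Finset.sum_add_distrib, Finset.mul_sum,
    ← Finset.sum_sub_distrib]
  refine Finset.sum_congr rfl fun n _ => ?_
  have hp := two_pi_I_mul_natCast_cpow_neg n.succ_pos (1 - s)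
  have hm := two_pi_I_mul_neg_natCast_cpow_neg n.succ_pos (1 - s)
  have he1 : Complex.exp (2 * π * Complex.I * α) ^ (n + 1) =
      Complex.exp (2 * π * Complex.I * ((n + 1 : ℕ) : ℂ) * α) := by
    rw [← Complex.exp_nat_mul]; congr 1; ring
  have he2 : Complex.exp (2 * π * Complex.I * (-α : ℝ)) ^ (n + 1) =
      Complex.exp (-(2 * π * Complex.I * ((n + 1 : ℕ) : ℂ) * α)) := by
    rw [← Complex.exp_nat_mul]; congr 1; push_cast; ring
  rw [aCoef, aCoef, he1, he2, ← neg_sub 1 s, Int.cast_neg, Int.cast_natCast, hp, hm]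
  ring
end
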